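/- arXiv:2505.03933 — 2 statements merged into one kernel-verified Lean document; each statement's English description precedes it below -/
import Mathlib

section
/- There is an uncountable family of pairwise non-homeomorphic Lelek-like fans; i.e., there exist an uncountable index set Λ and a family {X_λ : λ ∈ Λ} of Lelek-like fans such that for all λ₁, λ₂ ∈ Λ with λ₁ ≠ λ₂, the spaces X_{λ₁} and X_{λ₂} are not homeomorphic. -/
open Set Filter Topology

/-- A set `A` is an arc if it is homeomorphic to the closed unit interval `[0,1]`. -/
def IsArc {X : Type} [TopologicalSpace X] (A : Set X) : Prop :=
  Nonempty (↥(Set.Icc (0:ℝ) 1) ≃ₜ ↥A)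

/-- `x` is an end-point of the arc `A`: some homeomorphism `[0,1] ≃ₜ A` sends `0` to `x`. -/
def IsArcEndpoint {X : Type} [TopologicalSpace X] (A : Set X) (x : X) : Prop :=
  ∃ e : ↥(Set.Icc (0:ℝ) 1) ≃ₜ ↥A, ((e ⟨0, le_refl 0, zero_le_one⟩ : A) : X) = x

/-- A subcontinuum: a nonempty compact connected subset. -/
def IsSubcontinuum {X : Type} [TopologicalSpace X] (A : Set X) : Prop :=
  IsCompact A ∧ IsConnected A

/-- Every subcontinuum `C` is unicoherent: whenever `C = A ∪ B` with `A`, `B`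
subcontinua, the intersection `A ∩ B` is connected. -/
def HereditarilyUnicoherent (X : Type) [TopologicalSpace X] : Prop :=
  ∀ C A B : Set X, IsSubcontinuum C → IsSubcontinuum A → IsSubcontinuum B →
    A ∪ B = C → IsConnected (A ∩ B)

/-- A dendroid: an arcwise connected, hereditarily unicoherent (metrizable) continuum. -/
def IsDendroid (X : Type) [TopologicalSpace X] : Prop :=
  Nonempty X ∧ CompactSpace X ∧ ConnectedSpace X ∧ TopologicalSpace.MetrizableSpace X ∧
  (∀ x y : X, x ≠ y → ∃ A : Set X, IsArcEndpoint A x ∧ IsArcEndpoint A y) ∧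
  HereditarilyUnicoherent X

/-- The set of end-points of a dendroid: points which are end-points of every arc
containing them. -/
def DendroidEndpoints (X : Type) [TopologicalSpace X] : Set X :=
  {x | ∀ A : Set X, IsArc A → x ∈ A → IsArcEndpoint A x}

/-- The model simple triode `([-1,1] × {0}) ∪ ({0} × [0,1]) ⊆ ℝ²`. -/
def TSet : Set (ℝ × ℝ) := (Set.Icc (-1:ℝ) 1 ×ˢ ({0} : Set ℝ)) ∪ (({0} : Set ℝ) ×ˢ Set.Icc (0:ℝ) 1)

lemma zero_mem_TSet : ((0:ℝ), (0:ℝ)) ∈ TSet :=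
  Or.inl ⟨⟨by norm_num, by norm_num⟩, rfl⟩

/-- `T` is a simple triode with top `x`: some homeomorphism from the model triode onto `T`
sends `(0,0)` to `x`. -/
def IsSimpleTriodeWithTop {X : Type} [TopologicalSpace X] (T : Set X) (x : X) : Prop :=
  ∃ e : ↥TSet ≃ₜ ↥T, ((e ⟨((0:ℝ), (0:ℝ)), zero_mem_TSet⟩ : T) : X) = x

/-- `x` is a ramification point: the top of some simple triode contained in the space. -/
def IsRamificationPoint {X : Type} [TopologicalSpace X] (x : X) : Prop :=
  ∃ T : Set X, IsSimpleTriodeWithTop T x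

/-- A fan: a dendroid with at most one ramification point. -/
def IsFan (X : Type) [TopologicalSpace X] : Prop :=
  IsDendroid X ∧ ∀ x y : X, IsRamificationPoint x → IsRamificationPoint y → x = y

/-- `v` is the top of the fan: its ramification point if one exists, otherwise an end-point. -/
def IsFanTop {X : Type} [TopologicalSpace X] (v : X) : Prop :=
  IsRamificationPoint v ∨
    ((∀ x : X, ¬ IsRamificationPoint x) ∧ v ∈ DendroidEndpoints X)

/-- A Lelek-like fan: a fan whose set of end-points is dense. -/
def IsLelekLikeFan (X : Type) [TopologicalSpace X] : Prop :=
  IsFan X ∧ Dense (DendroidEndpoints X)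

/-- A space exhausted by arcs (`leg c`, possibly degenerate) issuing from a common point `top`,
indexed continuously away from `top` by the points of `C`. -/
structure LegStructure (X C : Type) [TopologicalSpace X] [TopologicalSpace C] where
  top : X
  base : X → C
  leg : C → ℝ → X
  height : C → ℝ
  height_nonneg : ∀ c, 0 ≤ height c
  continuousOn_base : ContinuousOn base {top}ᶜ
  continuousOn_leg : ∀ c, ContinuousOn (leg c) (Icc 0 (height c))
  injOn_leg : ∀ c, InjOn (leg c) (Icc 0 (height c))
  leg_zero : ∀ c, leg c 0 = top
  base_leg : ∀ c t, 0 < t → t ≤ height c → base (leg c t) = c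
  exists_leg_eq : ∀ x, ∃ t ∈ Icc 0 (height (base x)), leg (base x) t = x

lemma exists_continuousOn_extension {α X : Type} [TopologicalSpace α] [TopologicalSpace X]
    {S : Set α} {T : Set X} (e : S ≃ₜ T) (x : X) :
    ∃ E : α → X, ContinuousOn E S ∧ InjOn E S ∧ ∀ (p : α) (hp : p ∈ S), E p = e ⟨p, hp⟩ := by
  classical
  have h : ∀ (p : α) (hp : p ∈ S),
      (fun p => if h : p ∈ S then (e ⟨p, h⟩ : X) else x) p = e ⟨p, hp⟩ := by
    intro p hp
    simp [hp]
  refine ⟨_, ?_, ?_, h⟩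
  · rw [continuousOn_iff_continuous_domRestrict]
    have : S.domRestrict (fun p => if h : p ∈ S then (e ⟨p, h⟩ : X) else x) =
        fun p => (e p : X) := by
      funext p
      exact h p p.2
    rw [this]
    exact continuous_subtype_val.comp e.continuous
  · intro p hp q hq hpq
    rw [h p hp, h q hq] at hpq
    simpa using e.injective (Subtype.ext hpq)

lemma exists_arc_of_injOn {X : Type} [TopologicalSpace X] [T2Space X] {γ : ℝ → X} {a b : ℝ}
    (hab : a < b) (hc : ContinuousOn γ (Icc a b)) (hi : InjOn γ (Icc a b)) :
    ∃ A : Set X, IsArcEndpoint A (γ a) ∧ IsArcEndpoint A (γ b) := by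
  have hm : ∀ u : Icc (0 : ℝ) 1, a + u * (b - a) ∈ Icc a b := by
    rintro ⟨u, h0, h1⟩
    constructor <;> simp only <;> nlinarith
  let g : Icc (0 : ℝ) 1 → X := fun u => γ (a + u * (b - a))
  have gc : Continuous g := hc.comp_continuous (by fun_prop) hm
  have gi : Function.Injective g := by
    intro u v huv
    have := hi (hm u) (hm v) huv
    have h' : (b - a) ≠ 0 := by linarith
    exact Subtype.ext (mul_right_cancel₀ h' (add_left_cancel this))
  let φ := (gc.isClosedEmbedding gi).isEmbedding.toHomeomorph
  refine ⟨range g, ⟨φ, ?_⟩, ⟨unitInterval.symmHomeomorph.trans φ, ?_⟩⟩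
  · change γ (a + 0 * (b - a)) = _
    simp
  · change γ (a + (1 - 0) * (b - a)) = _
    simp

namespace LegStructure

variable {X C : Type} [TopologicalSpace X] [TopologicalSpace C] (F : LegStructure X C)

lemma leg_ne_top {c : C} {t : ℝ} (h0 : 0 < t) (h1 : t ≤ F.height c) : F.leg c t ≠ F.top := by
  rw [← F.leg_zero c]
  intro h
  have := F.injOn_leg c ⟨h0.le, h1⟩ ⟨le_rfl, F.height_nonneg c⟩ h
  linarith

lemma exists_leg_eq_of_base {x : X} {c : C} (h : x ≠ F.top → F.base x = c) :
    ∃ t ∈ Icc 0 (F.height c), F.leg c t = x := by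
  by_cases hx : x = F.top
  · exact ⟨0, ⟨le_rfl, F.height_nonneg c⟩, by rw [F.leg_zero, hx]⟩
  · rw [← h hx]
    exact F.exists_leg_eq x

lemma exists_pos_leg_eq {x : X} (hx : x ≠ F.top) :
    ∃ t, 0 < t ∧ t ≤ F.height (F.base x) ∧ F.leg (F.base x) t = x := by
  obtain ⟨t, ht, hleg⟩ := F.exists_leg_eq x
  refine ⟨t, lt_of_le_of_ne ht.1 ?_, ht.2, hleg⟩
  rintro rfl
  exact hx (by rw [← hleg, F.leg_zero])

lemma eq_of_leg_eq {c d : C} {s t : ℝ} (hs : 0 < s) (hs' : s ≤ F.height c) (ht : 0 ≤ t)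
    (ht' : t ≤ F.height d) (h : F.leg c s = F.leg d t) : c = d ∧ s = t := by
  have h0 : 0 < t := by
    refine lt_of_le_of_ne ht ?_
    rintro rfl
    exact F.leg_ne_top hs hs' (by rw [h, F.leg_zero])
  have hcd : c = d := by
    rw [← F.base_leg c s hs hs', h, F.base_leg d t h0 ht']
  subst hcd
  exact ⟨rfl, F.injOn_leg c ⟨hs.le, hs'⟩ ⟨ht, ht'⟩ h⟩

lemma isCompact_segment {c : C} {a b : ℝ} (ha : 0 ≤ a) (hb : b ≤ F.height c) :
    IsCompact (F.leg c '' Icc a b) :=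
  isCompact_Icc.image_of_continuousOn ((F.continuousOn_leg c).mono (Icc_subset_Icc ha hb))

lemma isPreconnected_segment {c : C} {a b : ℝ} (ha : 0 ≤ a) (hb : b ≤ F.height c) :
    IsPreconnected (F.leg c '' Icc a b) :=
  isPreconnected_Icc.image _ ((F.continuousOn_leg c).mono (Icc_subset_Icc ha hb))

section Compact

variable [T2Space X] [T2Space C] [CompactSpace C] [TotallyDisconnectedSpace C]

/-- A subcontinuum containing the top meets each leg in an initial segment. -/
lemma leg_mem_of_top_mem {K : Set X} (hK : IsCompact K) (hK' : IsPreconnected K)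
    (htop : F.top ∈ K) {c : C} {s t : ℝ} (hs : 0 ≤ s) (hst : s ≤ t) (ht : t ≤ F.height c)
    (hmem : F.leg c t ∈ K) : F.leg c s ∈ K := by
  by_contra hsK
  have hst' : s < t := lt_of_le_of_ne hst (by rintro rfl; exact hsK hmem)
  have hP : IsCompact (K ∩ F.leg c '' Icc s (F.height c)) :=
    hK.inter (F.isCompact_segment hs le_rfl)
  have hQ : IsCompact (K ∩ F.leg c '' Icc 0 s) :=
    hK.inter (F.isCompact_segment le_rfl (hst.trans ht))
  have hdisj : Disjoint (K ∩ F.leg c '' Icc s (F.height c)) (K ∩ F.leg c '' Icc 0 s) := by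
    rw [Set.disjoint_left]
    rintro _ ⟨h1, a, ha, rfl⟩ ⟨-, b, hb, hab⟩
    have := F.injOn_leg c ⟨hb.1, hb.2.trans (hst.trans ht)⟩ ⟨hs.trans ha.1, ha.2⟩ hab
    have : a = s := le_antisymm (by linarith [hb.2]) ha.1
    subst this
    exact hsK h1
  obtain ⟨OP, OQ, hOP, hOQ, hPO, hQO, hO⟩ := SeparatedNhds.of_isCompact_isCompact hP hQ hdisj
  have htopQ : F.top ∈ OQ :=
    hQO ⟨htop, 0, ⟨le_rfl, hs⟩, F.leg_zero c⟩
  have hZ : IsCompact (K \ (OP ∪ OQ)) := hK.diff (hOP.union hOQ)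
  have hZtop : K \ (OP ∪ OQ) ⊆ {F.top}ᶜ := by
    rintro x ⟨-, hx⟩ rfl
    exact hx (Or.inr htopQ)
  have hZc : c ∉ F.base '' (K \ (OP ∪ OQ)) := by
    rintro ⟨x, ⟨hxK, hx⟩, rfl⟩
    obtain ⟨a, ha, hax⟩ := F.exists_leg_eq x
    rcases le_total s a with h | h
    · exact hx (Or.inl (hPO ⟨hxK, a, ⟨h, ha.2⟩, hax⟩))
    · exact hx (Or.inr (hQO ⟨hxK, a, ⟨ha.1, h⟩, hax⟩))
  obtain ⟨U, hU, hcU, hUZ⟩ := compact_exists_isClopen_in_isOpen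
    (hZ.image_of_continuousOn (F.continuousOn_base.mono hZtop)).isClosed.isOpen_compl hZc
  have hW : IsOpen (OP ∩ ({F.top}ᶜ ∩ F.base ⁻¹' U)) :=
    hOP.inter (F.continuousOn_base.isOpen_inter_preimage isOpen_compl_singleton hU.isOpen)
  have hW' : IsOpen (OQ ∪ ({F.top}ᶜ ∩ F.base ⁻¹' Uᶜ)) :=
    hOQ.union (F.continuousOn_base.isOpen_inter_preimage isOpen_compl_singleton
      hU.compl.isOpen)
  have htpos : 0 < t := hs.trans_lt hst'
  obtain ⟨x, -, ⟨hx1, hx2, hx3⟩, hx4 | ⟨-, hx4⟩⟩ := hK' _ _ hW hW' (by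
      intro x hx
      by_cases hxQ : x ∈ OQ
      · exact Or.inr (Or.inl hxQ)
      have hxt : x ≠ F.top := by
        rintro rfl
        exact hxQ htopQ
      by_cases hxU : F.base x ∈ U
      · by_cases hxP : x ∈ OP
        · exact Or.inl ⟨hxP, hxt, hxU⟩
        · exact absurd ⟨x, ⟨hx, by simp [hxP, hxQ]⟩, rfl⟩ (hUZ hxU)
      · exact Or.inr (Or.inr ⟨hxt, hxU⟩))
    ⟨_, hmem, hPO ⟨hmem, t, ⟨hst, ht⟩, rfl⟩, F.leg_ne_top htpos ht,
      by simpa [F.base_leg c t htpos ht] using hcU⟩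
    ⟨_, htop, Or.inl htopQ⟩
  · exact Set.disjoint_left.1 hO hx1 hx4
  · exact hx4 hx3

omit [T2Space X] [T2Space C] [CompactSpace C] in
lemma base_eq_of_isPreconnected {K : Set X} (hK : IsPreconnected K) (htop : F.top ∉ K)
    {x y : X} (hx : x ∈ K) (hy : y ∈ K) : F.base x = F.base y :=
  (hK.image F.base (F.continuousOn_base.mono fun _ hz h => htop (h ▸ hz))).subsingleton
    (mem_image_of_mem _ hx) (mem_image_of_mem _ hy)

lemma ordConnected_preimage {K : Set X} (hK : IsSubcontinuum K) (c : C) :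
    (Icc 0 (F.height c) ∩ F.leg c ⁻¹' K).OrdConnected := by
  refine ⟨?_⟩
  rintro a ⟨ha, haK⟩ b ⟨hb, hbK⟩ s ⟨has, hsb⟩
  have h0s := ha.1.trans has
  refine ⟨⟨h0s, hsb.trans hb.2⟩, ?_⟩
  by_cases htop : F.top ∈ K
  · exact F.leg_mem_of_top_mem hK.1 hK.2.isPreconnected htop h0s hsb hb.2 hbK
  have hapos : 0 < a := by
    refine lt_of_le_of_ne ha.1 ?_
    rintro rfl
    exact htop (F.leg_zero c ▸ haK)
  have hbase : ∀ x ∈ K, F.base x = c := by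
    intro x hx
    rw [F.base_eq_of_isPreconnected hK.2.isPreconnected htop hx haK, F.base_leg c a hapos ha.2]
  obtain ⟨x, hxK, ⟨p, hp, rfl⟩, ⟨q, hq, hpq⟩⟩ :=
    isPreconnected_closed_iff.1 hK.2.isPreconnected _ _
      (F.isCompact_segment (c := c) le_rfl (hsb.trans hb.2)).isClosed
      (F.isCompact_segment (c := c) h0s le_rfl).isClosed
      (by
        intro x hx
        obtain ⟨t, ht, rfl⟩ := F.exists_leg_eq_of_base fun _ => hbase x hx
        rcases le_total t s with h | h
        · exact Or.inl ⟨t, ⟨ht.1, h⟩, rfl⟩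
        · exact Or.inr ⟨t, ⟨h, ht.2⟩, rfl⟩)
      ⟨_, haK, a, ⟨ha.1, has⟩, rfl⟩ ⟨_, hbK, b, ⟨hsb, hb.2⟩, rfl⟩
  have := F.injOn_leg c ⟨h0s.trans hq.1, hq.2⟩ ⟨hp.1, hp.2.trans (hsb.trans hb.2)⟩ hpq
  have : p = s := le_antisymm hp.2 (by linarith [hq.1])
  subst this
  exact hxK

lemma isConnected_inter_of_top_notMem {A B : Set X} (hA : IsSubcontinuum A)
    (hB : IsSubcontinuum B) (htop : F.top ∉ A) (hne : (A ∩ B).Nonempty) :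
    IsConnected (A ∩ B) := by
  refine ⟨hne, ?_⟩
  obtain ⟨x, hxA, hxB⟩ := hne
  have hord := (F.ordConnected_preimage hA (F.base x)).inter
    (F.ordConnected_preimage hB (F.base x))
  have himg : A ∩ B = F.leg (F.base x) '' ((Icc 0 (F.height (F.base x)) ∩ F.leg (F.base x) ⁻¹' A) ∩
      (Icc 0 (F.height (F.base x)) ∩ F.leg (F.base x) ⁻¹' B)) := by
    ext y
    constructor
    · rintro ⟨hyA, hyB⟩
      obtain ⟨t, ht, rfl⟩ := F.exists_leg_eq_of_base fun _ =>
        F.base_eq_of_isPreconnected hA.2.isPreconnected htop hyA hxA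
      exact ⟨t, ⟨⟨ht, hyA⟩, ⟨ht, hyB⟩⟩, rfl⟩
    · rintro ⟨t, ⟨⟨-, htA⟩, ⟨-, htB⟩⟩, rfl⟩
      exact ⟨htA, htB⟩
  rw [himg]
  exact hord.isPreconnected.image _ ((F.continuousOn_leg _).mono fun t ht => ht.1.1)

include F in
lemma hereditarilyUnicoherent : HereditarilyUnicoherent X := by
  rintro _ A B hC hA hB rfl
  have hne : (A ∩ B).Nonempty := by
    obtain ⟨x, -, hx⟩ := isPreconnected_closed_iff.1 hC.2.isPreconnected A B hA.1.isClosed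
      hB.1.isClosed Subset.rfl
      (hA.2.nonempty.mono fun x hx => ⟨Or.inl hx, hx⟩)
      (hB.2.nonempty.mono fun x hx => ⟨Or.inr hx, hx⟩)
    exact ⟨x, hx⟩
  by_cases htA : F.top ∈ A
  · by_cases htB : F.top ∈ B
    · refine ⟨hne, isPreconnected_of_forall F.top ?_⟩
      rintro y ⟨hyA, hyB⟩
      obtain ⟨t, ht, hty⟩ := F.exists_leg_eq y
      refine ⟨F.leg (F.base y) '' Icc 0 t, ?_, ⟨0, ⟨le_rfl, ht.1⟩, F.leg_zero _⟩,
        ⟨t, ⟨ht.1, le_rfl⟩, hty⟩, F.isPreconnected_segment le_rfl ht.2⟩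
      rintro _ ⟨s, hs, rfl⟩
      exact ⟨F.leg_mem_of_top_mem hA.1 hA.2.isPreconnected htA hs.1 hs.2 ht.2 (by rwa [hty]),
        F.leg_mem_of_top_mem hB.1 hB.2.isPreconnected htB hs.1 hs.2 ht.2 (by rwa [hty])⟩
    · rw [inter_comm] at hne ⊢
      exact F.isConnected_inter_of_top_notMem hB hA htB hne
  · exact F.isConnected_inter_of_top_notMem hA hB htA hne

omit [T2Space C] [CompactSpace C] [TotallyDisconnectedSpace C] in
include F in
lemma exists_arc {x y : X} (hxy : x ≠ y) :
    ∃ A : Set X, IsArcEndpoint A x ∧ IsArcEndpoint A y := by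
  have key : ∀ (c : C) (s t : ℝ), 0 ≤ s → s < t → t ≤ F.height c →
      ∃ A : Set X, IsArcEndpoint A (F.leg c s) ∧ IsArcEndpoint A (F.leg c t) :=
    fun c s t h0 h1 h2 =>
    exists_arc_of_injOn h1 ((F.continuousOn_leg c).mono (Icc_subset_Icc h0 h2))
      ((F.injOn_leg c).mono (Icc_subset_Icc h0 h2))
  by_cases hx : x = F.top
  · obtain ⟨t, h0, h1, hleg⟩ := F.exists_pos_leg_eq (x := y) (by rw [← hx]; exact hxy.symm)
    rw [hx, ← F.leg_zero (F.base y), ← hleg]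
    convert key (F.base y) 0 t le_rfl h0 h1 using 4
    simp [hleg]
  by_cases hy : y = F.top
  · obtain ⟨t, h0, h1, hleg⟩ := F.exists_pos_leg_eq hx
    obtain ⟨A, h, h'⟩ := key (F.base x) 0 t le_rfl h0 h1
    exact ⟨A, hleg ▸ h', by rwa [hy, ← F.leg_zero (F.base x)]⟩
  obtain ⟨s, hs0, hs1, hsx⟩ := F.exists_pos_leg_eq hx
  obtain ⟨t, ht0, ht1, hty⟩ := F.exists_pos_leg_eq hy
  generalize F.base x = c at *
  generalize F.base y = d at *
  subst hsx hty
  by_cases hcd : c = d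
  · subst hcd
    rcases lt_trichotomy s t with h | rfl | h
    · exact key c s t hs0.le h ht1
    · exact absurd rfl hxy
    · obtain ⟨A, h, h'⟩ := key c t s ht0.le h hs1
      exact ⟨A, h', h⟩
  let γ : ℝ → X := fun u => if u ≤ 0 then F.leg c (-u) else F.leg d u
  have hneg : ∀ u ≤ 0, γ u = F.leg c (-u) := fun u hu => if_pos hu
  have hpos : ∀ u, 0 ≤ u → γ u = F.leg d u := by
    intro u hu
    rcases hu.eq_or_lt with rfl | hu
    · rw [hneg 0 le_rfl, neg_zero, F.leg_zero, F.leg_zero]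
    · exact if_neg (not_le.2 hu)
  have h1 : γ (-s) = F.leg c s := by rw [hneg _ (by linarith), neg_neg]
  have h2 : γ t = F.leg d t := hpos _ ht0.le
  rw [← h1, ← h2]
  refine exists_arc_of_injOn (by linarith) ?_ ?_
  · have e : Icc (-s) t = Icc (-s) 0 ∪ Icc 0 t :=
      (Icc_union_Icc_eq_Icc (by linarith) ht0.le).symm
    rw [e]
    refine ContinuousOn.union_of_isClosed ?_ ?_ isClosed_Icc isClosed_Icc
    · refine ((F.continuousOn_leg c).comp continuousOn_neg ?_).congr fun u hu => hneg u hu.2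
      intro u hu
      exact ⟨by linarith [hu.2], by linarith [hu.1]⟩
    · exact ((F.continuousOn_leg d).mono (Icc_subset_Icc le_rfl ht1)).congr fun u hu => hpos u hu.1
  · have hinj : ∀ u v : ℝ, -s ≤ u → u < 0 → -s ≤ v → v ≤ t → γ u = γ v → u = v := by
      intro u v hu hu0 hvs hv huv
      rw [hneg u hu0.le] at huv
      rcases le_total v 0 with h | h
      · rw [hneg v h] at huv
        have := F.injOn_leg c ⟨by linarith, by linarith⟩ ⟨by linarith, by linarith⟩ huv
        linarith
      · rw [hpos v h] at huv
        exact absurd (F.eq_of_leg_eq (by linarith) (by linarith) h (by linarith) huv).1 hcd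
    intro u hu v hv huv
    rcases lt_or_ge u 0 with h | h
    · exact hinj u v hu.1 h hv.1 hv.2 huv
    rcases lt_or_ge v 0 with h' | h'
    · exact (hinj v u hv.1 h' hu.1 hu.2 huv.symm).symm
    rw [hpos u h, hpos v h'] at huv
    exact F.injOn_leg d ⟨h, hu.2.trans ht1⟩ ⟨h', hv.2.trans ht1⟩ huv

omit [T2Space C] [CompactSpace C] in
/-- An injective path starting at a point `x` other than the top begins inside the leg of `x`. -/
lemma exists_subcontinuum_of_path {α : ℝ → X} (hc : ContinuousOn α (Icc 0 1))
    (hi : InjOn α (Icc 0 1)) (h0 : α 0 ≠ F.top) :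
    ∃ A : Set X, A ⊆ α '' Icc 0 1 ∧ IsSubcontinuum A ∧ α 0 ∈ A ∧
      ∃ a ∈ Icc 0 (F.height (F.base (α 0))), F.leg (F.base (α 0)) a ∈ A ∧
        F.leg (F.base (α 0)) a ≠ α 0 := by
  have hev : ∀ᶠ t in 𝓝[Icc 0 1] (0 : ℝ), α t ≠ F.top :=
    (hc 0 ⟨le_rfl, zero_le_one⟩).eventually (isOpen_compl_singleton.mem_nhds h0)
  rw [eventually_nhdsWithin_iff, Metric.eventually_nhds_iff] at hev
  obtain ⟨δ, hδ, hev⟩ := hev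
  obtain ⟨ε, hε, hεδ⟩ := exists_between (lt_min hδ one_pos)
  have hε1 : ε ≤ 1 := hεδ.le.trans (min_le_right _ _)
  have hsub : Icc 0 ε ⊆ Icc (0 : ℝ) 1 := Icc_subset_Icc le_rfl hε1
  have hmem0 : (0 : ℝ) ∈ Icc 0 ε := ⟨le_rfl, hε.le⟩
  have hmem : ε ∈ Icc 0 ε := ⟨hε.le, le_rfl⟩
  have hconn : IsConnected (α '' Icc 0 ε) :=
    ⟨⟨_, mem_image_of_mem _ hmem0⟩, isPreconnected_Icc.image _ (hc.mono hsub)⟩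
  refine ⟨α '' Icc 0 ε, image_mono hsub,
    ⟨isCompact_Icc.image_of_continuousOn (hc.mono hsub), hconn⟩,
    mem_image_of_mem _ hmem0, ?_⟩
  have htop : F.top ∉ α '' Icc 0 ε := by
    rintro ⟨t, ht, htt⟩
    refine hev ?_ (hsub ht) htt
    rw [Real.dist_eq, sub_zero, abs_of_nonneg ht.1]
    exact ht.2.trans_lt (hεδ.trans_le (min_le_left _ _))
  obtain ⟨a, ha, haε⟩ := F.exists_leg_eq_of_base fun _ =>
    F.base_eq_of_isPreconnected hconn.isPreconnected htop (mem_image_of_mem _ hmem)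
      (mem_image_of_mem _ hmem0)
  refine ⟨a, ha, haε ▸ mem_image_of_mem _ hmem, ?_⟩
  rw [haε]
  intro h
  exact hε.ne' (hi (hsub hmem) (hsub hmem0) h)

/-- Two subcontinua meeting only in a point of a leg leave it in different directions. -/
lemma not_same_side {A B : Set X} (hA : IsSubcontinuum A) (hB : IsSubcontinuum B) {c : C}
    {s a b : ℝ} (hs : s ∈ Icc 0 (F.height c)) (ha : a ∈ Icc 0 (F.height c))
    (hb : b ∈ Icc 0 (F.height c)) (hsA : F.leg c s ∈ A) (hsB : F.leg c s ∈ B)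
    (haA : F.leg c a ∈ A) (hbB : F.leg c b ∈ B) (hAB : A ∩ B ⊆ {F.leg c s}) :
    ¬(s < a ∧ s < b) ∧ ¬(a < s ∧ b < s) := by
  have hoA := F.ordConnected_preimage hA c
  have hoB := F.ordConnected_preimage hB c
  constructor
  · rintro ⟨h1, h2⟩
    have hA' := hoA.out ⟨hs, hsA⟩ ⟨ha, haA⟩ ⟨le_min h1.le h2.le, min_le_left a b⟩
    have hB' := hoB.out ⟨hs, hsB⟩ ⟨hb, hbB⟩ ⟨le_min h1.le h2.le, min_le_right a b⟩
    have := F.injOn_leg c hA'.1 hs (hAB ⟨hA'.2, hB'.2⟩)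
    exact (lt_min h1 h2).ne' this
  · rintro ⟨h1, h2⟩
    have hA' := hoA.out ⟨ha, haA⟩ ⟨hs, hsA⟩ ⟨le_max_left a b, max_le h1.le h2.le⟩
    have hB' := hoB.out ⟨hb, hbB⟩ ⟨hs, hsB⟩ ⟨le_max_right a b, max_le h1.le h2.le⟩
    have := F.injOn_leg c hA'.1 hs (hAB ⟨hA'.2, hB'.2⟩)
    exact (max_lt h1 h2).ne this

lemma leg_height_mem_dendroidEndpoints {c : C} (hc : 0 < F.height c) :
    F.leg c (F.height c) ∈ DendroidEndpoints X := by
  rintro A ⟨e⟩ hx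
  obtain ⟨⟨t, ht⟩, hte⟩ := e.surjective ⟨_, hx⟩
  have hte' : (e ⟨t, ht⟩ : X) = F.leg c (F.height c) := by rw [hte]
  rcases ht.1.eq_or_lt with rfl | h0
  · exact ⟨e, hte'⟩
  rcases ht.2.eq_or_lt with rfl | h1
  · refine ⟨unitInterval.symmHomeomorph.trans e, ?_⟩
    rw [← hte']
    change (e (unitInterval.symm 0) : X) = _
    simp only [unitInterval.symm_zero]
    rfl
  exfalso
  obtain ⟨γ, γc, γi, γe⟩ := exists_continuousOn_extension e F.top
  have hγ : γ t = F.leg c (F.height c) := by rw [γe t ht, hte']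
  have hm1 : ∀ u ∈ Icc (0 : ℝ) 1, t * (1 - u) ∈ Icc (0 : ℝ) 1 := by
    rintro u ⟨hu0, hu1⟩
    constructor <;> nlinarith
  have hm2 : ∀ u ∈ Icc (0 : ℝ) 1, t + u * (1 - t) ∈ Icc (0 : ℝ) 1 := by
    rintro u ⟨hu0, hu1⟩
    constructor <;> nlinarith
  have htop := F.leg_ne_top hc le_rfl
  have hb := F.base_leg c _ hc le_rfl
  obtain ⟨A₁, hA₁, hA₁', hxA₁, a, ha, haA, hax⟩ := F.exists_subcontinuum_of_path
    (α := fun u => γ (t * (1 - u)))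
    (γc.comp (by fun_prop) hm1)
    (fun u hu v hv huv => by
      have := mul_left_cancel₀ h0.ne' (γi (hm1 u hu) (hm1 v hv) huv)
      linarith)
    (by simpa [hγ] using htop)
  obtain ⟨A₂, hA₂, hA₂', hxA₂, b, hb', hbA, hbx⟩ := F.exists_subcontinuum_of_path
    (α := fun u => γ (t + u * (1 - t)))
    (γc.comp (by fun_prop) hm2)
    (fun u hu v hv huv => by
      have := mul_right_cancel₀ (by linarith : (1 - t) ≠ 0) (add_left_cancel
        (γi (hm2 u hu) (hm2 v hv) huv))
      exact this)
    (by simpa [hγ] using htop)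
  simp only [sub_zero, mul_one, zero_mul, add_zero, hγ, hb] at hxA₁ hxA₂ ha hb' haA hbA hax hbx
  refine (F.not_same_side hA₁' hA₂' ⟨hc.le, le_rfl⟩ ha hb' hxA₁ hxA₂ haA hbA ?_).2
    ⟨lt_of_le_of_ne ha.2 fun h => hax (by rw [h]), lt_of_le_of_ne hb'.2 fun h => hbx (by rw [h])⟩
  rintro x ⟨hx1, hx2⟩
  obtain ⟨u, hu, rfl⟩ := hA₁ hx1
  obtain ⟨v, hv, huv⟩ := hA₂ hx2
  have := γi (hm2 v hv) (hm1 u hu) huv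
  have hu0 : t * u + v * (1 - t) = 0 := by linarith
  have : t * u = 0 := by nlinarith [mul_nonneg h0.le hu.1, mul_nonneg hv.1 (sub_nonneg.2 h1.le)]
  simp only [mul_sub, mul_one, this, sub_zero, hγ, mem_singleton_iff]

lemma eq_top_of_isRamificationPoint {x : X} (hx : IsRamificationPoint x) : x = F.top := by
  by_contra hxt
  obtain ⟨T, e, rfl⟩ := hx
  obtain ⟨E, Ec, Ei, Ee⟩ := exists_continuousOn_extension e F.top
  rw [← Ee] at hxt
  have hm1 : ∀ u ∈ Icc (0 : ℝ) 1, (-u, (0 : ℝ)) ∈ TSet := fun u hu =>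
    Or.inl ⟨⟨by linarith [hu.2], by linarith [hu.1]⟩, rfl⟩
  have hm2 : ∀ u ∈ Icc (0 : ℝ) 1, (u, (0 : ℝ)) ∈ TSet := fun u hu =>
    Or.inl ⟨⟨by linarith [hu.1], hu.2⟩, rfl⟩
  have hm3 : ∀ u ∈ Icc (0 : ℝ) 1, ((0 : ℝ), u) ∈ TSet := fun u hu => Or.inr ⟨rfl, hu⟩
  obtain ⟨A₁, hA₁, hA₁', hxA₁, a₁, ha₁, haA₁, hax₁⟩ := F.exists_subcontinuum_of_path
    (α := fun u => E (-u, 0)) (Ec.comp (by fun_prop) hm1)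
    (fun u hu v hv huv => by simpa using Ei (hm1 u hu) (hm1 v hv) huv) (by simpa using hxt)
  obtain ⟨A₂, hA₂, hA₂', hxA₂, a₂, ha₂, haA₂, hax₂⟩ := F.exists_subcontinuum_of_path
    (α := fun u => E (u, 0)) (Ec.comp (by fun_prop) hm2)
    (fun u hu v hv huv => by simpa using Ei (hm2 u hu) (hm2 v hv) huv) hxt
  obtain ⟨A₃, hA₃, hA₃', hxA₃, a₃, ha₃, haA₃, hax₃⟩ := F.exists_subcontinuum_of_path
    (α := fun u => E (0, u)) (Ec.comp (by fun_prop) hm3)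
    (fun u hu v hv huv => by simpa using Ei (hm3 u hu) (hm3 v hv) huv) hxt
  simp only [neg_zero] at *
  obtain ⟨s, hs, hsx⟩ := F.exists_leg_eq (E (0, 0))
  generalize F.base (E (0, 0)) = c at *
  have h12 : A₁ ∩ A₂ ⊆ {F.leg c s} := by
    rintro y ⟨h1, h2⟩
    obtain ⟨u, hu, rfl⟩ := hA₁ h1
    obtain ⟨v, hv, huv⟩ := hA₂ h2
    have := (Prod.ext_iff.1 (Ei (hm2 v hv) (hm1 u hu) huv)).1
    have hu0 : u = 0 := le_antisymm (by simp only at this; linarith [hv.1]) hu.1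
    simp [hu0, hsx]
  have h13 : A₁ ∩ A₃ ⊆ {F.leg c s} := by
    rintro y ⟨h1, h2⟩
    obtain ⟨u, hu, rfl⟩ := hA₁ h1
    obtain ⟨v, hv, huv⟩ := hA₃ h2
    have := (Prod.ext_iff.1 (Ei (hm3 v hv) (hm1 u hu) huv)).1
    have hu0 : u = 0 := by simpa using this
    simp [hu0, hsx]
  have h23 : A₂ ∩ A₃ ⊆ {F.leg c s} := by
    rintro y ⟨h1, h2⟩
    obtain ⟨u, hu, rfl⟩ := hA₂ h1
    obtain ⟨v, hv, huv⟩ := hA₃ h2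
    have := (Prod.ext_iff.1 (Ei (hm3 v hv) (hm2 u hu) huv)).1
    have hu0 : u = 0 := this.symm
    simp [hu0, hsx]
  rw [← hsx] at hxA₁ hxA₂ hxA₃ hax₁ hax₂ hax₃
  have n12 := F.not_same_side hA₁' hA₂' hs ha₁ ha₂ hxA₁ hxA₂ haA₁ haA₂ h12
  have n13 := F.not_same_side hA₁' hA₃' hs ha₁ ha₃ hxA₁ hxA₃ haA₁ haA₃ h13
  have n23 := F.not_same_side hA₂' hA₃' hs ha₂ ha₃ hxA₂ hxA₃ haA₂ haA₃ h23
  have hne : ∀ a, F.leg c a ≠ F.leg c s → a < s ∨ s < a := fun a h =>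
    lt_or_gt_of_ne fun h' => h (by rw [h'])
  rcases hne _ hax₁ with h1 | h1 <;> rcases hne _ hax₂ with h2 | h2 <;>
    rcases hne _ hax₃ with h3 | h3 <;> tauto

include F in
theorem isFan [CompactSpace X] [TopologicalSpace.MetrizableSpace X] : IsFan X := by
  have hconn : IsPreconnected (univ : Set X) := isPreconnected_of_forall F.top fun y _ => by
    obtain ⟨t, ht, hty⟩ := F.exists_leg_eq y
    exact ⟨F.leg (F.base y) '' Icc 0 t, subset_univ _, ⟨0, ⟨le_rfl, ht.1⟩, F.leg_zero _⟩,
      ⟨t, ⟨ht.1, le_rfl⟩, hty⟩, F.isPreconnected_segment le_rfl ht.2⟩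
  refine ⟨⟨⟨F.top⟩, inferInstance, ?_, inferInstance, fun x y hxy => F.exists_arc hxy,
    F.hereditarilyUnicoherent⟩, fun x y hx hy => ?_⟩
  · exact { isPreconnected_univ := hconn, toNonempty := ⟨F.top⟩ }
  · rw [F.eq_top_of_isRamificationPoint hx, F.eq_top_of_isRamificationPoint hy]

end Compact

end LegStructure

section Invariants

variable {X Y : Type} [TopologicalSpace X] [TopologicalSpace Y]

/-- Three points distinct from `v` that no connected set can join in pairs while avoiding `v`. -/
def IsHub (v : X) : Prop :=
  ∃ w : Fin 3 → X, (∀ i, w i ≠ v) ∧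
    ∀ i j, i ≠ j → ∀ K : Set X, IsPreconnected K → w i ∈ K → w j ∈ K → v ∈ K

/-- Every subcontinuum joining `v` to `x` passes through `z`. -/
def Precedes (v z x : X) : Prop :=
  ∀ K : Set X, IsCompact K → IsPreconnected K → v ∈ K → x ∈ K → z ∈ K

/-- Distinct points that precede each other in the closure of the order `Precedes v`. -/
def Entangled (v x z : X) : Prop :=
  x ≠ z ∧ (z, x) ∈ closure {p : X × X | Precedes v p.1 p.2} ∧
    (x, z) ∈ closure {p : X × X | Precedes v p.1 p.2}

/-- Points that are entangled with some point but do not separate two entangled points. -/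
def IsMarked (v x : X) : Prop :=
  (∃ z, Entangled v x z) ∧
    ∀ z w, z ≠ x → w ≠ x → Precedes v z x → Precedes v x w → ¬Entangled v z w

lemma Entangled.symm {v x z : X} (h : Entangled v x z) : Entangled v z x :=
  ⟨h.1.symm, h.2.2, h.2.1⟩

lemma IsHub.map (φ : X ≃ₜ Y) {v : X} (h : IsHub v) : IsHub (φ v) := by
  obtain ⟨w, hw, hK⟩ := h
  refine ⟨fun i => φ (w i), fun i => by simpa using hw i, fun i j hij K hKc hi hj => ?_⟩
  refine hK i j hij (φ ⁻¹' K) ?_ hi hj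
  rwa [φ.isPreconnected_preimage]

lemma precedes_homeomorph_iff (φ : X ≃ₜ Y) {v z x : X} :
    Precedes (φ v) (φ z) (φ x) ↔ Precedes v z x := by
  constructor
  · intro h K hK hK' hv hx
    simpa using h (φ '' K) (hK.image φ.continuous) (hK'.image φ φ.continuous.continuousOn)
      (mem_image_of_mem _ hv) (mem_image_of_mem _ hx)
  · intro h K hK hK' hv hx
    exact h (φ ⁻¹' K) (by rwa [φ.isCompact_preimage]) (by rwa [φ.isPreconnected_preimage]) hv hx

lemma entangled_homeomorph_iff (φ : X ≃ₜ Y) {v x z : X} :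
    Entangled (φ v) (φ x) (φ z) ↔ Entangled v x z := by
  have hpre : {p : X × X | Precedes v p.1 p.2} =
      (φ.prodCongr φ) ⁻¹' {p : Y × Y | Precedes (φ v) p.1 p.2} := by
    ext p
    exact (precedes_homeomorph_iff φ).symm
  have hcl : ∀ a b : X, (a, b) ∈ closure {p : X × X | Precedes v p.1 p.2} ↔
      (φ a, φ b) ∈ closure {p : Y × Y | Precedes (φ v) p.1 p.2} := by
    intro a b
    rw [hpre, ← Homeomorph.preimage_closure]
    rfl
  simp only [Entangled, hcl, ne_eq, φ.injective.eq_iff]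

lemma isMarked_homeomorph_iff (φ : X ≃ₜ Y) {v x : X} :
    IsMarked (φ v) (φ x) ↔ IsMarked v x := by
  simp only [IsMarked, φ.surjective.exists, φ.surjective.forall, entangled_homeomorph_iff,
    precedes_homeomorph_iff, ne_eq, φ.injective.eq_iff]

end Invariants

namespace LegStructure

variable {X C : Type} [TopologicalSpace X] [TopologicalSpace C] (F : LegStructure X C)
  [T2Space X] [T2Space C] [CompactSpace C] [TotallyDisconnectedSpace C]

omit [T2Space X] [T2Space C] [CompactSpace C] [TotallyDisconnectedSpace C] in
lemma exists_of_precedes {z x : X} (h : Precedes F.top z x) :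
    ∃ c s t, 0 ≤ s ∧ s ≤ t ∧ t ≤ F.height c ∧ F.leg c s = z ∧ F.leg c t = x := by
  obtain ⟨t, ht, htx⟩ := F.exists_leg_eq x
  obtain ⟨s, hs, hsz⟩ := h (F.leg (F.base x) '' Icc 0 t) (F.isCompact_segment le_rfl ht.2)
    (F.isPreconnected_segment le_rfl ht.2) ⟨0, ⟨le_rfl, ht.1⟩, F.leg_zero _⟩
    ⟨t, ⟨ht.1, le_rfl⟩, htx⟩
  exact ⟨_, s, t, hs.1, hs.2, ht.2, hsz, htx⟩

lemma precedes_leg {c : C} {s t : ℝ} (hs : 0 ≤ s) (hst : s ≤ t) (ht : t ≤ F.height c) :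
    Precedes F.top (F.leg c s) (F.leg c t) := fun _ hK hK' htop hx =>
  F.leg_mem_of_top_mem hK hK' htop hs hst ht hx

lemma precedes_leg_iff {c : C} {s t : ℝ} (hs : s ∈ Icc 0 (F.height c))
    (ht : t ∈ Icc 0 (F.height c)) : Precedes F.top (F.leg c s) (F.leg c t) ↔ s ≤ t := by
  refine ⟨fun h => ?_, fun h => F.precedes_leg hs.1 h ht.2⟩
  obtain ⟨d, s', t', h0, h1, h2, hs', ht'⟩ := F.exists_of_precedes h
  rcases hs.1.eq_or_lt with rfl | hs0
  · exact ht.1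
  obtain ⟨rfl, rfl⟩ := F.eq_of_leg_eq hs0 hs.2 h0 (h1.trans h2) hs'.symm
  have := F.injOn_leg _ ⟨h0.trans h1, h2⟩ ht ht'
  linarith

omit [T2Space X] [T2Space C] [CompactSpace C] [TotallyDisconnectedSpace C] in
lemma eq_top_of_isHub {v : X} (hv : IsHub v) : v = F.top := by
  by_contra hvt
  obtain ⟨w, hw, hK⟩ := hv
  obtain ⟨s, hs0, hs1, hsv⟩ := F.exists_pos_leg_eq hvt
  generalize F.base v = c at *
  subst hsv
  have key : ∀ i, (∃ K, IsPreconnected K ∧ F.top ∈ K ∧ w i ∈ K ∧ F.leg c s ∉ K) ∨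
      ∃ a, s < a ∧ a ≤ F.height c ∧ F.leg c a = w i := by
    intro i
    obtain ⟨t, ht, htw⟩ := F.exists_leg_eq (w i)
    by_cases h : F.leg c s ∈ F.leg (F.base (w i)) '' Icc 0 t
    · obtain ⟨u, hu, hus⟩ := h
      obtain ⟨hc, rfl⟩ := F.eq_of_leg_eq hs0 hs1 hu.1 (hu.2.trans ht.2) hus.symm
      rw [← hc] at ht htw
      refine Or.inr ⟨t, lt_of_le_of_ne hu.2 ?_, ht.2, htw⟩
      rintro rfl
      exact hw i htw.symm
    · exact Or.inl ⟨_, F.isPreconnected_segment le_rfl ht.2, ⟨0, ⟨le_rfl, ht.1⟩, F.leg_zero _⟩,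
        ⟨t, ⟨ht.1, le_rfl⟩, htw⟩, h⟩
  have h1 : ∀ i j, i ≠ j → (∃ K, IsPreconnected K ∧ F.top ∈ K ∧ w i ∈ K ∧ F.leg c s ∉ K) →
      ¬∃ K, IsPreconnected K ∧ F.top ∈ K ∧ w j ∈ K ∧ F.leg c s ∉ K := by
    rintro i j hij ⟨A, hA, hAt, hiA, hsA⟩ ⟨B, hB, hBt, hjB, hsB⟩
    rcases hK i j hij _ (hA.union _ hAt hBt hB) (Or.inl hiA) (Or.inr hjB) with h | h
    · exact hsA h
    · exact hsB h
  have h2 : ∀ i j, i ≠ j → (∃ a, s < a ∧ a ≤ F.height c ∧ F.leg c a = w i) →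
      ¬∃ a, s < a ∧ a ≤ F.height c ∧ F.leg c a = w j := by
    rintro i j hij ⟨a, hsa, hac, hai⟩ ⟨b, hsb, hbc, hbj⟩
    have h0 : 0 ≤ min a b := hs0.le.trans (le_min hsa.le hsb.le)
    obtain ⟨u, hu, hus⟩ := hK i j hij _
      (F.isPreconnected_segment (c := c) h0 (max_le hac hbc))
      ⟨a, ⟨min_le_left _ _, le_max_left _ _⟩, hai⟩ ⟨b, ⟨min_le_right _ _, le_max_right _ _⟩, hbj⟩
    have := F.injOn_leg c ⟨h0.trans hu.1, hu.2.trans (max_le hac hbc)⟩ ⟨hs0.le, hs1⟩ hus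
    exact (lt_min hsa hsb).not_ge (this ▸ hu.1)
  have h01 : (0 : Fin 3) ≠ 1 := by decide
  have h02 : (0 : Fin 3) ≠ 2 := by decide
  have h12 : (1 : Fin 3) ≠ 2 := by decide
  rcases key 0 with k0 | k0 <;> rcases key 1 with k1 | k1
  · exact h1 0 1 h01 k0 k1
  · rcases key 2 with k2 | k2
    · exact h1 0 2 h02 k0 k2
    · exact h2 1 2 h12 k1 k2
  · rcases key 2 with k2 | k2
    · exact h1 1 2 h12 k1 k2
    · exact h2 0 2 h02 k0 k2
  · exact h2 0 1 h01 k0 k1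

omit [T2Space X] [T2Space C] [CompactSpace C] in
lemma isHub_top {c : Fin 3 → C} (hc : Function.Injective c) (hpos : ∀ i, 0 < F.height (c i)) :
    IsHub F.top := by
  refine ⟨fun i => F.leg (c i) (F.height (c i)), fun i => F.leg_ne_top (hpos i) le_rfl,
    fun i j hij K hK hi hj => ?_⟩
  by_contra htop
  have := F.base_eq_of_isPreconnected hK htop hi hj
  rw [F.base_leg _ _ (hpos i) le_rfl, F.base_leg _ _ (hpos j) le_rfl] at this
  exact hij (hc this)

end LegStructure

/-- The path `t ↦ t` up to height `M`, followed by a descent to height `m`. -/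
def fold (m M t : ℝ) : ℝ := max (min t (2 * M - t)) (min t m)

/-- The points `1 / (k + 1)`. -/
noncomputable def node (k : ℕ) : ℝ := 1 / ((k : ℝ) + 1)

lemma continuous_fold (m M : ℝ) : Continuous (fold m M) := by
  unfold fold
  fun_prop

lemma fold_of_le {m M t : ℝ} (ht : t ≤ M) : fold m M t = t := by
  unfold fold
  rw [min_eq_left (by linarith : t ≤ 2 * M - t), max_eq_left (min_le_left _ _)]

lemma fold_two_mul_sub {m M y : ℝ} (hy : m ≤ y) (hy' : y ≤ M) : fold m M (2 * M - y) = y := by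
  unfold fold
  rw [sub_sub_cancel, min_eq_right (by linarith : y ≤ 2 * M - y),
    max_eq_left ((min_le_right _ _).trans hy)]

lemma fold_le {m M : ℝ} (hmM : m ≤ M) (t : ℝ) : fold m M t ≤ M := by
  refine max_le ?_ ((min_le_right _ _).trans hmM)
  rcases le_total t M with h | h
  · exact (min_le_left _ _).trans h
  · exact (min_le_right _ _).trans (by linarith)

lemma min_le_fold (m M t : ℝ) : min t m ≤ fold m M t := le_max_right _ _

lemma fold_zero {m M : ℝ} (hM : 0 ≤ M) : fold m M 0 = 0 := fold_of_le hM

lemma fold_pos {m M t : ℝ} (hm : 0 < m) (ht : 0 < t) : 0 < fold m M t :=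
  (lt_min ht hm).trans_le (min_le_fold m M t)

lemma fold_le_fold_or {m M s t : ℝ} (hmM : m ≤ M) (hst : s ≤ t) :
    fold m M s ≤ fold m M t ∨ fold m M s ∈ Icc m M ∧ fold m M t ∈ Icc m M := by
  rcases le_total t M with h | h
  · rw [fold_of_le h, fold_of_le (hst.trans h)]
    exact Or.inl hst
  · have ht : m ≤ fold m M t := by
      simpa [min_eq_right (hmM.trans h)] using min_le_fold m M t
    rcases le_total m (fold m M s) with h' | h'
    · exact Or.inr ⟨⟨h', fold_le hmM s⟩, ⟨ht, fold_le hmM t⟩⟩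
    · exact Or.inl (h'.trans ht)

lemma node_pos (k : ℕ) : 0 < node k := by
  unfold node
  positivity

lemma node_zero : node 0 = 1 := by simp [node]

lemma node_strictAnti : StrictAnti node := by
  intro j k hjk
  unfold node
  have : (j : ℝ) < k := by exact_mod_cast hjk
  exact one_div_lt_one_div_of_lt (by positivity) (by linarith)

lemma node_le_one (k : ℕ) : node k ≤ 1 := node_zero ▸ node_strictAnti.antitone (Nat.zero_le k)

lemma node_succ_le (k : ℕ) : node (k + 1) ≤ node k := node_strictAnti.antitone (Nat.le_succ k)

lemma node_mem_Icc (k : ℕ) : node k ∈ Icc (0 : ℝ) 1 := ⟨(node_pos k).le, node_le_one k⟩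

lemma Icc_node_subset (k : ℕ) : Icc (node (k + 1)) (node k) ⊆ Icc 0 1 :=
  Icc_subset_Icc (node_pos _).le (node_le_one _)

lemma left_mem_Icc_node (k : ℕ) : node (k + 1) ∈ Icc (node (k + 1)) (node k) :=
  left_mem_Icc.2 (node_succ_le k)

lemma right_mem_Icc_node (k : ℕ) : node k ∈ Icc (node (k + 1)) (node k) :=
  right_mem_Icc.2 (node_succ_le k)

lemma node_succ_ne (k : ℕ) : node (k + 1) ≠ node k := (node_strictAnti k.lt_succ_self).ne

lemma two_mul_node_sub_lt_two (k : ℕ) : 2 * node k - node (k + 1) < 2 := by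
  linarith [node_pos (k + 1), node_le_one k]

/-- The order of `ℝ` together with all pairs that lie in a common interval between consecutive
nodes selected by `K`. -/
def blockOrder (K : Set ℕ) : Set (ℝ × ℝ) :=
  {p | p.1 ≤ p.2 ∨ ∃ k ∈ K, p.1 ∈ Icc (node (k + 1)) (node k) ∧ p.2 ∈ Icc (node (k + 1)) (node k)}

lemma isClosed_blockOrder (K : Set ℕ) : IsClosed (blockOrder K) := by
  have h : blockOrder K = ⋂ N : ℕ, ({p : ℝ × ℝ | p.1 ≤ p.2 + node N} ∪
      ⋃ k ∈ K ∩ Iio N, Icc (node (k + 1)) (node k) ×ˢ Icc (node (k + 1)) (node k)) := by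
    ext ⟨a, b⟩
    simp only [blockOrder, mem_ofPred_eq, mem_iInter, mem_union, mem_iUnion, mem_prod, exists_prop,
      mem_inter_iff, mem_Iio]
    constructor
    · rintro (hab | ⟨k, hk, ha, hb⟩) N
      · exact Or.inl (by linarith [node_pos N])
      · rcases lt_or_ge k N with h | h
        · exact Or.inr ⟨k, ⟨hk, h⟩, ha, hb⟩
        · have := node_strictAnti.antitone h
          exact Or.inl (by linarith [ha.2, hb.1, node_pos (k + 1)])
    · intro h
      by_cases hab : a ≤ b
      · exact Or.inl hab
      obtain ⟨N, hN⟩ := exists_nat_one_div_lt (sub_pos.2 (not_le.1 hab))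
      rcases h N with h | ⟨k, ⟨hk, -⟩, ha, hb⟩
      · change node N < a - b at hN
        linarith
      · exact Or.inr ⟨k, hk, ha, hb⟩
  rw [h]
  refine isClosed_iInter fun N => IsClosed.union ?_ ?_
  · exact isClosed_le (by fun_prop) (by fun_prop)
  · exact ((finite_Iio N).subset inter_subset_right).isClosed_biUnion fun k _ =>
      isClosed_Icc.prod isClosed_Icc

lemma exists_block_of_mem_blockOrder {K : Set ℕ} {a b : ℝ} (hab : a ≠ b)
    (h₁ : (a, b) ∈ blockOrder K) (h₂ : (b, a) ∈ blockOrder K) :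
    ∃ k ∈ K, a ∈ Icc (node (k + 1)) (node k) ∧ b ∈ Icc (node (k + 1)) (node k) := by
  rcases h₁ with h₁ | h₁
  · rcases h₂ with h₂ | ⟨k, hk, h, h'⟩
    · exact absurd (le_antisymm h₁ h₂) hab
    · exact ⟨k, hk, h', h⟩
  · exact h₁

/-- An assignment of a length bound and of a block in `K` to each index, in which every block
appears with a dense set of bounds arbitrarily far out. -/
structure FoldPattern (K : Set ℕ) where
  bound : ℕ → ℝ
  block : ℕ → ℕ
  bound_mem : ∀ i, bound i ∈ Ioo (0 : ℝ) 2
  block_mem : ∀ i, block i ∈ K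
  exists_index : ∀ N, ∀ k ∈ K, ∀ a b, 0 ≤ a → a < b → b ≤ 2 →
    ∃ i ≥ N, block i = k ∧ bound i ∈ Ioo a b

lemma FoldPattern.nonempty {K : Set ℕ} (hK : 0 ∈ K) : Nonempty (FoldPattern K) := by
  classical
  have : Nonempty (Ioo (0 : ℝ) 2) := ⟨⟨1, by norm_num, by norm_num⟩⟩
  let ρ := TopologicalSpace.denseSeq (Ioo (0 : ℝ) 2)
  refine ⟨⟨fun i => ρ i.unpair.2.unpair.1,
    fun i => if i.unpair.2.unpair.2 ∈ K then i.unpair.2.unpair.2 else 0,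
    fun i => (ρ _).2, fun i => ?_, ?_⟩⟩
  · split_ifs with h
    exacts [h, hK]
  · intro N k hk a b ha hab hb
    obtain ⟨c, hac, hcb⟩ := exists_between hab
    obtain ⟨j, hj⟩ := (TopologicalSpace.denseRange_denseSeq (Ioo (0 : ℝ) 2)).exists_mem_open
      (isOpen_Ioo.preimage continuous_subtype_val : IsOpen (Subtype.val ⁻¹' Ioo a b))
      ⟨⟨c, ha.trans_lt hac, hcb.trans_le hb⟩, hac, hcb⟩
    exact ⟨Nat.pair N (Nat.pair j k), Nat.left_le_pair _ _, by simpa using fun h => absurd hk h,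
      by simpa using hj⟩

namespace FoldPattern

/-- The real value of a digit. -/
def digit (b : Bool) : ℝ := if b then 1 else 0

lemma continuous_digit : Continuous digit := continuous_of_discreteTopology

/-- `n` is the first index at which `c` is `true`. -/
def IsFirst (c : ℕ → Bool) (n : ℕ) : Prop := c n = true ∧ ∀ j < n, c j = false

lemma IsFirst.eq {c : ℕ → Bool} {m n : ℕ} (hm : IsFirst c m) (hn : IsFirst c n) : m = n := by
  rcases lt_trichotomy m n with h | h | h
  · simpa [hm.1] using hn.2 m h
  · exact h
  · simpa [hn.1] using hm.2 n h

lemma exists_isFirst {c : ℕ → Bool} (h : ∃ i, c i = true) : ∃ n, IsFirst c n := by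
  classical
  exact ⟨Nat.find h, Nat.find_spec h, fun j hj => by simpa using Nat.find_min h hj⟩

lemma isClopen_isFirst (n : ℕ) : IsClopen {c | IsFirst c n} := by
  have : {c | IsFirst c n} = (fun c : ℕ → Bool => c n) ⁻¹' {true} ∩
      ⋂ j ∈ Iio n, (fun c : ℕ → Bool => c j) ⁻¹' {false} := by
    ext c
    simp [IsFirst]
  rw [this]
  exact ((isClopen_discrete _).preimage (continuous_apply n)).inter
    ((finite_Iio n).isClopen_biInter fun j _ => (isClopen_discrete _).preimage (continuous_apply j))

/-- The position in `ℝ × ℝ^ℕ × ℝ^ℕ` of the point with direction `c`, parameter `t` and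
height `y`. -/
def embed (p : (ℕ → Bool) × ℝ × ℝ) : ℝ × (ℕ → ℝ) × (ℕ → ℝ) :=
  (p.2.2, fun i => digit (p.1 i) * p.2.2, fun i => digit (p.1 i) * p.2.1)

lemma continuous_embed : Continuous embed := by
  have : ∀ i, Continuous fun p : (ℕ → Bool) × ℝ × ℝ => digit (p.1 i) := fun i =>
    continuous_digit.comp ((continuous_apply i).comp continuous_fst)
  unfold embed
  refine continuous_snd.snd.prodMk (Continuous.prodMk ?_ ?_)
  · exact continuous_pi fun i => (this i).mul (by fun_prop)
  · exact continuous_pi fun i => (this i).mul (by fun_prop)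

variable {K : Set ℕ} (P : FoldPattern K)

/-- The folding of the legs whose first index is `n`. -/
noncomputable def profile (n : ℕ) : ℝ → ℝ := fold (node (P.block n + 1)) (node (P.block n))

/-- The admissible triples of direction, parameter and height. -/
def dom : Set ((ℕ → Bool) × ℝ × ℝ) :=
  {p | p.2.1 ∈ Icc 0 2 ∧ p.2.2 ∈ Icc 0 1 ∧ (∀ i, p.1 i = true → p.2.1 ≤ P.bound i) ∧
    ∀ n, IsFirst p.1 n → p.2.2 = P.profile n p.2.1}

lemma isCompact_dom : IsCompact P.dom := by
  have hcomp : IsCompact ((univ : Set (ℕ → Bool)) ×ˢ (Icc (0 : ℝ) 2 ×ˢ Icc (0 : ℝ) 1)) :=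
    isCompact_univ.prod (isCompact_Icc.prod isCompact_Icc)
  refine hcomp.of_isClosed_subset ?_ fun p hp => ⟨mem_univ _, hp.1, hp.2.1⟩
  have h1 : IsClosed {p : (ℕ → Bool) × ℝ × ℝ | ∀ i, p.1 i = true → p.2.1 ≤ P.bound i} := by
    simp only [ofPred_forall]
    refine isClosed_iInter fun i => isClosed_imp ?_ (isClosed_le (by fun_prop) continuous_const)
    have h : Continuous fun p : (ℕ → Bool) × ℝ × ℝ => p.1 i :=
      (continuous_apply i).comp continuous_fst
    exact (isOpen_discrete {true}).preimage h
  have h2 : IsClosed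
      {p : (ℕ → Bool) × ℝ × ℝ | ∀ n, IsFirst p.1 n → p.2.2 = P.profile n p.2.1} := by
    simp only [ofPred_forall]
    exact isClosed_iInter fun n => isClosed_imp
      ((isClopen_isFirst n).isOpen.preimage continuous_fst)
      (isClosed_eq (by fun_prop) ((continuous_fold _ _).comp (by fun_prop)))
  have h3 : IsClosed {p : (ℕ → Bool) × ℝ × ℝ | p.2.1 ∈ Icc 0 2} :=
    isClosed_Icc.preimage (by fun_prop)
  have h4 : IsClosed {p : (ℕ → Bool) × ℝ × ℝ | p.2.2 ∈ Icc 0 1} :=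
    isClosed_Icc.preimage (by fun_prop)
  exact h3.inter (h4.inter (h1.inter h2))

/-- The fan determined by the pattern. -/
abbrev Carrier : Type := ↥(embed '' P.dom)

instance : CompactSpace P.Carrier :=
  isCompact_iff_compactSpace.1 (P.isCompact_dom.image continuous_embed)

lemma profile_zero (n : ℕ) : P.profile n 0 = 0 := fold_zero (node_pos _).le

lemma profile_pos (n : ℕ) {t : ℝ} (ht : 0 < t) : 0 < P.profile n t := fold_pos (node_pos _) ht

lemma profile_le_one (n : ℕ) (t : ℝ) : P.profile n t ≤ 1 :=
  (fold_le (node_succ_le _) t).trans (node_le_one _)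

open Classical in
/-- The height along the leg with direction `c`. -/
noncomputable def level (c : ℕ → Bool) (t : ℝ) : ℝ :=
  if h : ∃ i, c i = true then P.profile (exists_isFirst h).choose t else t

open Classical in
/-- The length of the leg with direction `c`. -/
noncomputable def length (c : ℕ → Bool) : ℝ :=
  if ∃ i, c i = true then sInf (insert 2 (P.bound '' {i | c i = true})) else 1

lemma level_of_isFirst {c : ℕ → Bool} {n : ℕ} (h : IsFirst c n) : P.level c = P.profile n := by
  have hc : ∃ i, c i = true := ⟨n, h.1⟩
  funext t
  rw [level, dif_pos hc, (exists_isFirst hc).choose_spec.eq h]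

lemma level_of_not {c : ℕ → Bool} (h : ¬∃ i, c i = true) (t : ℝ) : P.level c t = t := dif_neg h

lemma length_of_not {c : ℕ → Bool} (h : ¬∃ i, c i = true) : P.length c = 1 := if_neg h

lemma le_length_iff {c : ℕ → Bool} (h : ∃ i, c i = true) {t : ℝ} :
    t ≤ P.length c ↔ t ≤ 2 ∧ ∀ i, c i = true → t ≤ P.bound i := by
  rw [length, if_pos h, le_csInf_iff _ ⟨2, mem_insert _ _⟩]
  · simp
  · refine ⟨0, ?_⟩
    rintro _ (rfl | ⟨i, -, rfl⟩)
    exacts [zero_le_two, (P.bound_mem i).1.le]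

lemma continuous_level (c : ℕ → Bool) : Continuous (P.level c) := by
  by_cases h : ∃ i, c i = true
  · obtain ⟨n, hn⟩ := exists_isFirst h
    rw [P.level_of_isFirst hn]
    exact continuous_fold _ _
  · exact continuous_id.congr fun t => (P.level_of_not h t).symm

lemma level_zero (c : ℕ → Bool) : P.level c 0 = 0 := by
  by_cases h : ∃ i, c i = true
  · obtain ⟨n, hn⟩ := exists_isFirst h
    rw [P.level_of_isFirst hn, P.profile_zero]
  · exact P.level_of_not h 0

lemma level_pos (c : ℕ → Bool) {t : ℝ} (ht : 0 < t) : 0 < P.level c t := by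
  by_cases h : ∃ i, c i = true
  · obtain ⟨n, hn⟩ := exists_isFirst h
    rw [P.level_of_isFirst hn]
    exact P.profile_pos n ht
  · rwa [P.level_of_not h t]

lemma length_nonneg (c : ℕ → Bool) : 0 ≤ P.length c := by
  by_cases h : ∃ i, c i = true
  · rw [P.le_length_iff h]
    exact ⟨zero_le_two, fun i _ => (P.bound_mem i).1.le⟩
  · rw [P.length_of_not h]
    exact zero_le_one

lemma mem_dom {c : ℕ → Bool} {t : ℝ} (h0 : 0 ≤ t) (h1 : t ≤ P.length c) :
    (c, t, P.level c t) ∈ P.dom := by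
  by_cases h : ∃ i, c i = true
  · obtain ⟨n, hn⟩ := exists_isFirst h
    rw [P.le_length_iff h] at h1
    rw [P.level_of_isFirst hn]
    refine ⟨⟨h0, h1.1⟩, ⟨?_, P.profile_le_one n t⟩, h1.2, fun m hm => by rw [hm.eq hn]⟩
    rcases h0.eq_or_lt with rfl | h0
    exacts [(P.profile_zero n).ge, (P.profile_pos n h0).le]
  · rw [P.length_of_not h] at h1
    rw [P.level_of_not h]
    push Not at h
    exact ⟨⟨h0, h1.trans one_le_two⟩, ⟨h0, h1⟩, fun i hi => absurd hi (h i),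
      fun n hn => absurd hn.1 (h n)⟩

/-- The common point of the legs. -/
noncomputable def vertex : P.Carrier :=
  ⟨_, mem_image_of_mem embed (P.mem_dom (c := fun _ => false) le_rfl (P.length_nonneg _))⟩

lemma embed_zero (c : ℕ → Bool) : embed (c, 0, 0) = 0 := by
  ext <;> simp [embed]

lemma vertex_val : (P.vertex : ℝ × (ℕ → ℝ) × (ℕ → ℝ)) = 0 := by
  simp only [vertex, P.level_zero, embed_zero]

open Classical in
/-- The leg with direction `c`. -/
noncomputable def leg (c : ℕ → Bool) (t : ℝ) : P.Carrier :=
  if h : embed (c, t, P.level c t) ∈ embed '' P.dom then ⟨_, h⟩ else P.vertex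

lemma leg_val {c : ℕ → Bool} {t : ℝ} (h0 : 0 ≤ t) (h1 : t ≤ P.length c) :
    (P.leg c t : ℝ × (ℕ → ℝ) × (ℕ → ℝ)) = embed (c, t, P.level c t) := by
  rw [leg, dif_pos (mem_image_of_mem embed (P.mem_dom h0 h1))]

/-- The direction of a point. -/
noncomputable def direction (x : ℝ × (ℕ → ℝ) × (ℕ → ℝ)) (i : ℕ) : Bool := decide (x.2.1 i ≠ 0)

lemma direction_embed {c : ℕ → Bool} {t y : ℝ} (hy : y ≠ 0) : direction (embed (c, t, y)) = c := by
  funext i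
  cases h : c i <;> simp [direction, embed, digit, h, hy]

lemma height_eq_zero_iff {x : P.Carrier} : x.1.1 = 0 ↔ x = P.vertex := by
  constructor
  · rintro h
    obtain ⟨_, ⟨c, t, y⟩, ⟨h1, h2, h3, h4⟩, rfl⟩ := x
    obtain rfl : y = 0 := h
    apply Subtype.ext
    rw [vertex_val]
    by_cases hc : ∃ i, c i = true
    · obtain ⟨n, hn⟩ := exists_isFirst hc
      obtain rfl : t = 0 := by
        by_contra ht
        exact (P.profile_pos n (lt_of_le_of_ne h1.1 (Ne.symm ht))).ne (h4 n hn)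
      exact embed_zero c
    · push Not at hc
      ext <;> simp [embed, digit, hc]
  · rintro rfl
    rw [vertex_val]
    rfl

lemma continuousOn_direction : ContinuousOn (fun x : P.Carrier => direction x) {P.vertex}ᶜ := by
  refine continuousOn_pi.2 fun i => ?_
  intro x hx
  have h0 : x.1.1 ≠ 0 := fun h => hx (P.height_eq_zero_iff.1 h)
  have hd : ∀ z : P.Carrier, z.1.2.1 i = 0 ∨ z.1.2.1 i = z.1.1 := by
    rintro ⟨_, ⟨c, t, y⟩, -, rfl⟩
    cases h : c i <;> simp [embed, digit, h]
  have hc : Continuous fun z : P.Carrier => z.1.2.1 i :=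
    (continuous_apply i).comp continuous_subtype_val.snd.fst
  have hc' : Continuous fun z : P.Carrier => z.1.1 := continuous_subtype_val.fst
  refine ContinuousAt.continuousWithinAt ?_
  rw [ContinuousAt, nhds_discrete Bool, tendsto_pure]
  by_cases hxi : x.1.2.1 i = 0
  · have : ∀ᶠ z : P.Carrier in 𝓝 x, z.1.2.1 i ≠ z.1.1 :=
      (isOpen_ne_fun hc hc').mem_nhds (by simpa [hxi] using h0.symm)
    filter_upwards [this] with z hz
    simp [direction, hxi, (hd z).resolve_right hz]
  · have : ∀ᶠ z : P.Carrier in 𝓝 x, z.1.2.1 i ≠ 0 :=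
      (isOpen_ne_fun hc continuous_const).mem_nhds hxi
    filter_upwards [this] with z hz
    simp [direction, hxi, hz]

lemma exists_leg_eq_embed {c : ℕ → Bool} {t y : ℝ} (h : (c, t, y) ∈ P.dom) :
    ∃ s, 0 ≤ s ∧ s ≤ P.length c ∧ P.level c s = y ∧
      embed (c, s, P.level c s) = embed (c, t, y) := by
  obtain ⟨h1, h2, h3, h4⟩ := h
  by_cases hc : ∃ i, c i = true
  · obtain ⟨n, hn⟩ := exists_isFirst hc
    have hy : P.level c t = y := by rw [P.level_of_isFirst hn]; exact (h4 n hn).symm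
    exact ⟨t, h1.1, (P.le_length_iff hc).2 ⟨h1.2, h3⟩, hy, by rw [hy]⟩
  · refine ⟨y, h2.1, by rw [P.length_of_not hc]; exact h2.2, P.level_of_not hc y, ?_⟩
    rw [P.level_of_not hc]
    push Not at hc
    ext <;> simp [embed, digit, hc]

/-- The leg structure of the fan. -/
noncomputable def legStructure : LegStructure P.Carrier (ℕ → Bool) where
  top := P.vertex
  base x := direction x
  leg := P.leg
  height := P.length
  height_nonneg := P.length_nonneg
  continuousOn_base := P.continuousOn_direction
  continuousOn_leg c := by
    rw [Topology.IsInducing.subtypeVal.continuousOn_iff]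
    refine ContinuousOn.congr (f := fun t => embed (c, t, P.level c t)) ?_
      fun t ht => P.leg_val ht.1 ht.2
    exact (continuous_embed.comp (continuous_const.prodMk
      (continuous_id.prodMk (P.continuous_level c)))).continuousOn
  injOn_leg c s hs t ht h := by
    have h' := congrArg Subtype.val h
    rw [P.leg_val hs.1 hs.2, P.leg_val ht.1 ht.2] at h'
    by_cases hc : ∃ i, c i = true
    · obtain ⟨i, hi⟩ := hc
      simpa [embed, digit, hi] using congrFun (congrArg (fun p => p.2.2) h') i
    · simpa [embed, P.level_of_not hc] using congrArg (fun p => p.1) h'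
  leg_zero c := by
    apply Subtype.ext
    rw [P.leg_val le_rfl (P.length_nonneg c), P.level_zero, embed_zero, vertex_val]
  base_leg c t h0 h1 := by
    rw [P.leg_val h0.le h1]
    exact direction_embed (P.level_pos c h0).ne'
  exists_leg_eq x := by
    by_cases hx : x = P.vertex
    · refine ⟨0, ⟨le_rfl, P.length_nonneg _⟩, ?_⟩
      apply Subtype.ext
      rw [P.leg_val le_rfl (P.length_nonneg _), P.level_zero, embed_zero, hx, vertex_val]
    · have h0 : x.1.1 ≠ 0 := fun h => hx (P.height_eq_zero_iff.1 h)
      obtain ⟨_, ⟨c, t, y⟩, hp, rfl⟩ := x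
      obtain ⟨s, hs0, hs1, -, hs⟩ := P.exists_leg_eq_embed hp
      simp only [direction_embed (show y ≠ 0 from h0)]
      exact ⟨s, ⟨hs0, hs1⟩, Subtype.ext (by rw [P.leg_val hs0 hs1, hs])⟩


lemma tendsto_leg {c : ℕ → ℕ → Bool} {d : ℕ → Bool} {t : ℕ → ℝ} {s y : ℝ} {x : P.Carrier}
    (hc : ∀ j, ∀ᶠ N in atTop, c N j = d j) (ht : Tendsto t atTop (𝓝 s))
    (hmem : ∀ N, t N ∈ Icc 0 (P.length (c N)))
    (hy : Tendsto (fun N => P.level (c N) (t N)) atTop (𝓝 y))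
    (hx : (x : ℝ × (ℕ → ℝ) × (ℕ → ℝ)) = embed (d, s, y)) :
    Tendsto (fun N => P.leg (c N) (t N)) atTop (𝓝 x) := by
  rw [tendsto_subtype_rng, hx]
  have hcd : Tendsto c atTop (𝓝 d) :=
    tendsto_pi_nhds.2 fun j => tendsto_const_nhds.congr' ((hc j).mono fun _ h => h.symm)
  refine ((continuous_embed.tendsto _).comp (hcd.prodMk_nhds (ht.prodMk_nhds hy))).congr fun N => ?_
  exact (P.leg_val (hmem N).1 (hmem N).2).symm

/-- The direction whose only index is `i`. -/
def single (i : ℕ) : ℕ → Bool := fun j => decide (j = i)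

lemma isFirst_single (i : ℕ) : IsFirst (single i) i :=
  ⟨by simp [single], fun j hj => by simp [single, hj.ne]⟩

lemma single_injective : Function.Injective single := fun i j h => by
  simpa [single] using congrFun h i

lemma length_single (i : ℕ) : P.length (single i) = P.bound i := by
  have h : ∃ j, single i j = true := ⟨i, (isFirst_single i).1⟩
  refine le_antisymm (((P.le_length_iff h).1 le_rfl).2 i (isFirst_single i).1) ?_
  refine (P.le_length_iff h).2 ⟨(P.bound_mem i).2.le, fun j hj => ?_⟩
  obtain rfl : j = i := by simpa [single] using hj
  exact le_rfl

/-- The point at height `y` of the leg on which the other legs accumulate. -/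
noncomputable def spine (y : ℝ) : P.Carrier := P.leg (fun _ => false) y

lemma length_false : P.length (fun _ => false) = 1 := P.length_of_not (by simp)

lemma spine_val {y : ℝ} (hy : y ∈ Icc (0 : ℝ) 1) (t : ℝ) :
    (P.spine y : ℝ × (ℕ → ℝ) × (ℕ → ℝ)) = embed (fun _ => false, t, y) := by
  rw [spine, P.leg_val hy.1 (hy.2.trans P.length_false.ge), P.level_of_not (by simp)]
  simp [embed, digit]

lemma injOn_spine : InjOn P.spine (Icc 0 1) := by
  have := P.legStructure.injOn_leg fun _ => false
  rwa [show P.legStructure.height (fun _ => false) = 1 from P.length_false] at this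

lemma precedes_spine_iff {s t : ℝ} (hs : s ∈ Icc (0 : ℝ) 1) (ht : t ∈ Icc (0 : ℝ) 1) :
    Precedes P.vertex (P.spine s) (P.spine t) ↔ s ≤ t := by
  rw [← P.length_false] at hs ht
  exact P.legStructure.precedes_leg_iff hs ht

lemma tendsto_leg_single {i : ℕ → ℕ} {t y : ℝ} (hi : ∀ N, N ≤ i N) (ht : 0 ≤ t)
    (hti : ∀ N, t ≤ P.bound (i N)) (hy : y ∈ Icc (0 : ℝ) 1) (hyi : ∀ N, P.profile (i N) t = y) :
    Tendsto (fun N => P.leg (single (i N)) t) atTop (𝓝 (P.spine y)) := by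
  refine P.tendsto_leg (d := fun _ => false) (s := t) (y := y) (fun j => ?_) tendsto_const_nhds
    (fun N => ⟨ht, (hti N).trans (P.length_single _).ge⟩) ?_ (P.spine_val hy t)
  · filter_upwards [eventually_gt_atTop j] with N hN
    have := hi N
    simp [single, show j ≠ i N by omega]
  · simp only [P.level_of_isFirst (isFirst_single _), hyi, tendsto_const_nhds]

lemma leg_length_mem_dendroidEndpoints {c : ℕ → Bool} (hc : 0 < P.length c) :
    P.leg c (P.length c) ∈ DendroidEndpoints P.Carrier :=
  P.legStructure.leg_height_mem_dendroidEndpoints hc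

lemma leg_mem_closure_dendroidEndpoints {c : ℕ → Bool} (hc : ∃ i, c i = true) (h0 : 0 ∈ K) {t : ℝ}
    (ht : 0 < t) (htc : t ≤ P.length c) : P.leg c t ∈ closure (DendroidEndpoints P.Carrier) := by
  obtain ⟨n, hn⟩ := exists_isFirst hc
  have ht' := (P.le_length_iff hc).1 htc
  have ht2 : t < 2 := (ht'.2 n hn.1).trans_lt (P.bound_mem n).2
  choose i hi _ hib using fun N : ℕ => P.exists_index (N + n + 1) 0 h0 t (min 2 (t + node N))
    ht.le (lt_min ht2 (by linarith [node_pos N])) (min_le_left _ _)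
  let d : ℕ → ℕ → Bool := fun N j => (decide (j < N + n + 1) && c j) || decide (j = i N)
  have hd : ∀ N, IsFirst (d N) n := by
    intro N
    have := hi N
    refine ⟨by simp [d, hn.1], fun j hj => ?_⟩
    simp [d, hn.2 j hj, show j ≠ i N by omega]
  have hex : ∀ N, ∃ j, d N j = true := fun N => ⟨n, (hd N).1⟩
  have hlow : ∀ N, t ≤ P.length (d N) := by
    intro N
    refine (P.le_length_iff (hex N)).2 ⟨ht2.le, fun j hj => ?_⟩
    have hj' : (j < N + n + 1 ∧ c j = true) ∨ j = i N := by simpa [d] using hj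
    rcases hj' with h | rfl
    exacts [ht'.2 j h.2, (hib N).1.le]
  have hup : ∀ N, P.length (d N) ≤ t + node N := fun N =>
    (((P.le_length_iff (hex N)).1 le_rfl).2 (i N) (by simp [d])).trans
      ((hib N).2.le.trans (min_le_right _ _))
  have hlim : Tendsto (fun N => P.length (d N)) atTop (𝓝 t) := by
    refine tendsto_of_tendsto_of_tendsto_of_le_of_le tendsto_const_nhds ?_ hlow hup
    simpa [node] using tendsto_const_nhds.add (tendsto_one_div_add_atTop_nhds_zero_nat (𝕜 := ℝ))
  refine mem_closure_of_tendsto (P.tendsto_leg (d := c) (s := t) (y := P.level c t) (fun j => ?_)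
    hlim (fun N => ⟨P.length_nonneg _, le_rfl⟩) ?_ (P.leg_val ht.le htc))
    (Eventually.of_forall fun N => P.leg_length_mem_dendroidEndpoints (ht.trans_le (hlow N)))
  · filter_upwards [eventually_gt_atTop j] with N hN
    have := hi N
    simp [d, show j ≤ N + n by omega, show j ≠ i N by omega]
  · simp only [P.level_of_isFirst (hd _), P.level_of_isFirst hn]
    exact ((continuous_fold _ _).tendsto t).comp hlim

lemma spine_mem_closure_dendroidEndpoints (h0 : 0 ∈ K) {y : ℝ} (hy : 0 < y) (hy1 : y ≤ 1) :
    P.spine y ∈ closure (DendroidEndpoints P.Carrier) := by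
  choose i hi hblock hib using fun N : ℕ =>
    P.exists_index N 0 h0 1 2 zero_le_one one_lt_two le_rfl
  have hb : ∀ N, y ≤ P.bound (i N) := fun N => hy1.trans (hib N).1.le
  rw [← closure_closure]
  refine mem_closure_of_tendsto (P.tendsto_leg_single hi hy.le hb ⟨hy.le, hy1⟩ fun N => ?_)
    (Eventually.of_forall fun N => P.leg_mem_closure_dendroidEndpoints
      ⟨i N, (isFirst_single _).1⟩ h0 hy ((hb N).trans (P.length_single _).ge))
  rw [profile, hblock, node_zero, fold_of_le hy1]

lemma dense_dendroidEndpoints (h0 : 0 ∈ K) : Dense (DendroidEndpoints P.Carrier) := by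
  intro x
  by_cases hx : x = P.vertex
  · rw [← closure_closure]
    refine mem_closure_of_tendsto (f := fun N => P.spine (node N)) (P.tendsto_leg
      (d := fun _ => false) (s := 0) (y := 0) (fun j => Eventually.of_forall fun _ => rfl)
      tendsto_one_div_add_atTop_nhds_zero_nat (fun N => ?_) ?_ ?_)
      (Eventually.of_forall fun N =>
        P.spine_mem_closure_dendroidEndpoints h0 (node_pos N) (node_le_one N))
    · rw [P.length_false]
      exact node_mem_Icc N
    · simp only [P.level_of_not (c := fun _ => false) (by simp)]
      exact tendsto_one_div_add_atTop_nhds_zero_nat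
    · rw [hx, vertex_val, embed_zero]
  · obtain ⟨t, ht, htc, htx⟩ := P.legStructure.exists_pos_leg_eq hx
    generalize P.legStructure.base x = c at htc htx
    subst htx
    by_cases hc : ∃ i, c i = true
    · exact P.leg_mem_closure_dendroidEndpoints hc h0 ht htc
    · obtain rfl : c = fun _ => false := by
        funext i
        simpa using not_exists.1 hc i
      exact P.spine_mem_closure_dendroidEndpoints h0 ht (htc.trans P.length_false.le)

lemma isLelekLikeFan (h0 : 0 ∈ K) : IsLelekLikeFan P.Carrier :=
  ⟨P.legStructure.isFan, P.dense_dendroidEndpoints h0⟩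

lemma isHub_vertex : IsHub P.vertex := by
  refine P.legStructure.isHub_top (c := ![fun _ => false, single 0, single 1]) ?_ ?_
  · have h : ∀ i, (fun _ => false) ≠ single i := fun i h => by
      simpa [single] using congrFun h i
    have h01 : single 0 ≠ single 1 := single_injective.ne zero_ne_one
    intro a b hab
    fin_cases a <;> fin_cases b <;> simp_all [(h 0).symm, (h 1).symm, h01.symm]
  · intro i
    change 0 < P.length _
    fin_cases i
    · simp [length_false]
    · simpa [length_single] using (P.bound_mem 0).1
    · simpa [length_single] using (P.bound_mem 1).1

lemma map_vertex {L : Set ℕ} (Q : FoldPattern L) (φ : P.Carrier ≃ₜ Q.Carrier) :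
    φ P.vertex = Q.vertex :=
  Q.legStructure.eq_top_of_isHub (P.isHub_vertex.map φ)

lemma exists_of_mem_closure_precedes {z x : P.Carrier}
    (h : (z, x) ∈ closure {p : P.Carrier × P.Carrier | Precedes P.vertex p.1 p.2}) :
    ∃ c s t a b, (c, s, a) ∈ P.dom ∧ (c, t, b) ∈ P.dom ∧
      (z : ℝ × (ℕ → ℝ) × (ℕ → ℝ)) = embed (c, s, a) ∧
      (x : ℝ × (ℕ → ℝ) × (ℕ → ℝ)) = embed (c, t, b) ∧ s ≤ t ∧ (a, b) ∈ blockOrder K := by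
  let S : Set (((ℕ → Bool) × ℝ × ℝ) × ((ℕ → Bool) × ℝ × ℝ)) := (P.dom ×ˢ P.dom) ∩
    {p | p.1.1 = p.2.1 ∧ p.1.2.1 ≤ p.2.2.1 ∧ (p.1.2.2, p.2.2.2) ∈ blockOrder K}
  have hS : IsCompact S := by
    refine (P.isCompact_dom.prod P.isCompact_dom).inter_right ?_
    exact (isClosed_eq continuous_fst.fst continuous_snd.fst).inter
      ((isClosed_le continuous_fst.snd.fst continuous_snd.snd.fst).inter
        ((isClosed_blockOrder K).preimage (continuous_fst.snd.snd.prodMk continuous_snd.snd.snd)))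
  have hcl : IsClosed ((Prod.map Subtype.val Subtype.val : P.Carrier × P.Carrier → _) ⁻¹'
      (Prod.map embed embed '' S)) :=
    (hS.image (continuous_embed.prodMap continuous_embed)).isClosed.preimage
      (continuous_subtype_val.prodMap continuous_subtype_val)
  have hsub : {p : P.Carrier × P.Carrier | Precedes P.vertex p.1 p.2} ⊆
      Prod.map Subtype.val Subtype.val ⁻¹' (Prod.map embed embed '' S) := by
    rintro ⟨z, x⟩ hzx
    obtain ⟨c, s, t, hs, hst, ht, rfl, rfl⟩ := P.legStructure.exists_of_precedes hzx
    change t ≤ P.length c at ht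
    refine ⟨((c, s, P.level c s), (c, t, P.level c t)),
      ⟨⟨P.mem_dom hs (hst.trans ht), P.mem_dom (hs.trans hst) ht⟩, rfl, hst, ?_⟩,
      Prod.ext (P.leg_val hs (hst.trans ht)).symm (P.leg_val (hs.trans hst) ht).symm⟩
    by_cases hc : ∃ i, c i = true
    · obtain ⟨n, hn⟩ := exists_isFirst hc
      simp only [P.level_of_isFirst hn]
      exact (fold_le_fold_or (node_succ_le _) hst).imp id fun h => ⟨_, P.block_mem n, h⟩
    · simp only [P.level_of_not hc]
      exact Or.inl hst
  obtain ⟨⟨⟨c, s, a⟩, d, t, b⟩, ⟨⟨h1, h2⟩, h3, h4, h5⟩, h6⟩ := closure_minimal hsub hcl h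
  obtain rfl : c = d := h3
  rw [Prod.map_apply, Prod.map_apply, Prod.mk.injEq] at h6
  exact ⟨c, s, t, a, b, h1, h2, h6.1.symm, h6.2.symm, h4, h5⟩

lemma exists_of_entangled {x z : P.Carrier} (h : Entangled P.vertex x z) :
    ∃ a b, a ≠ b ∧ x = P.spine a ∧ z = P.spine b ∧
      ∃ k ∈ K, a ∈ Icc (node (k + 1)) (node k) ∧ b ∈ Icc (node (k + 1)) (node k) := by
  obtain ⟨hne, h1, h2⟩ := h
  obtain ⟨c, s, t, b, a, hb, ha, hz, hx, hst, hba⟩ := P.exists_of_mem_closure_precedes h1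
  obtain ⟨d, t', s', a', b', -, -, hx', hz', hts, hab⟩ := P.exists_of_mem_closure_precedes h2
  obtain rfl : a = a' := congrArg Prod.fst (hx.symm.trans hx')
  obtain rfl : b = b' := congrArg Prod.fst (hz.symm.trans hz')
  have hpos : 0 < a ∧ 0 < b := by
    by_cases heq : a = b
    · subst heq
      rcases ha.2.1.1.eq_or_lt with rfl | h0
      · exact absurd ((P.height_eq_zero_iff.1 (congrArg Prod.fst hx)).trans
          (P.height_eq_zero_iff.1 (congrArg Prod.fst hz)).symm) hne
      · exact ⟨h0, h0⟩
    · obtain ⟨k, -, h, h'⟩ := exists_block_of_mem_blockOrder heq hab hba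
      exact ⟨(node_pos _).trans_le h.1, (node_pos _).trans_le h'.1⟩
  obtain rfl : c = d := by
    rw [← direction_embed (c := c) (t := t) hpos.1.ne', ← hx, hx', direction_embed hpos.1.ne']
  have hc : ¬∃ i, c i = true := by
    intro hc
    obtain ⟨n, hn⟩ := exists_isFirst hc
    have key : ∀ {u v w : ℝ}, embed (c, u, w) = embed (c, v, w) → u = v := fun h => by
      simpa [embed, digit, hn.1] using congrFun (congrArg (fun p => p.2.2) h) n
    obtain rfl := key (hx.symm.trans hx')
    obtain rfl := key (hz.symm.trans hz')
    obtain rfl := le_antisymm hst hts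
    obtain rfl : a = b := (ha.2.2.2 n hn).trans (hb.2.2.2 n hn).symm
    exact hne (Subtype.ext (hx.trans hz.symm))
  obtain rfl : c = fun _ => false := by
    funext i
    simpa using not_exists.1 hc i
  have hxa : x = P.spine a := Subtype.ext (hx.trans (P.spine_val ha.2.1 t).symm)
  have hzb : z = P.spine b := Subtype.ext (hz.trans (P.spine_val hb.2.1 s).symm)
  have hne' : a ≠ b := by
    rintro rfl
    exact hne (hxa.trans hzb.symm)
  exact ⟨a, b, hne', hxa, hzb, exists_block_of_mem_blockOrder hne' hab hba⟩

lemma entangled_spine_of_lt {k : ℕ} (hk : k ∈ K) {a b : ℝ} (ha : node (k + 1) ≤ a) (hab : a < b)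
    (hb : b ≤ node k) : Entangled P.vertex (P.spine a) (P.spine b) := by
  have ha1 := Icc_node_subset k ⟨ha, hab.le.trans hb⟩
  have hb1 := Icc_node_subset k ⟨ha.trans hab.le, hb⟩
  refine ⟨fun h => hab.ne (P.injOn_spine ha1 hb1 h), ?_,
    subset_closure ((P.precedes_spine_iff ha1 hb1).2 hab.le)⟩
  choose i hi hblock hib using fun N : ℕ => P.exists_index N k hk (2 * node k - node (k + 1)) 2
    (by linarith [node_succ_le k, node_pos k]) (two_mul_node_sub_lt_two k) le_rfl
  have h1 : ∀ N, 2 * node k - a ≤ P.bound (i N) := fun N => by linarith [(hib N).1]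
  have h2 : ∀ N, b ≤ P.bound (i N) := fun N => by linarith [h1 N]
  refine mem_closure_of_tendsto ((P.tendsto_leg_single hi hb1.1 h2 hb1 fun N => ?_).prodMk_nhds
    (P.tendsto_leg_single hi (by linarith [hb1.1] : 0 ≤ 2 * node k - a) h1 ha1 fun N => ?_))
    (Eventually.of_forall fun N => ?_)
  · rw [profile, hblock, fold_of_le hb]
  · rw [profile, hblock, fold_two_mul_sub ha (hab.le.trans hb)]
  · exact P.legStructure.precedes_leg hb1.1 (by linarith)
      ((h1 N).trans (P.length_single _).ge)

lemma entangled_spine {k : ℕ} (hk : k ∈ K) {a b : ℝ} (ha : a ∈ Icc (node (k + 1)) (node k))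
    (hb : b ∈ Icc (node (k + 1)) (node k)) (hab : a ≠ b) :
    Entangled P.vertex (P.spine a) (P.spine b) := by
  rcases hab.lt_or_gt with h | h
  · exact P.entangled_spine_of_lt hk ha.1 h hb.2
  · exact Entangled.symm (P.entangled_spine_of_lt hk hb.1 h ha.2)

lemma entangled_spine_node_iff {k : ℕ} :
    Entangled P.vertex (P.spine (node k)) (P.spine (node (k + 1))) ↔ k ∈ K := by
  refine ⟨fun h => ?_, fun hk => P.entangled_spine hk (right_mem_Icc_node k)
    (left_mem_Icc_node k) (node_succ_ne k).symm⟩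
  obtain ⟨a, b, -, ha, hb, j, hj, haj, hbj⟩ := P.exists_of_entangled h
  obtain rfl := P.injOn_spine (node_mem_Icc k) (Icc_node_subset j haj) ha
  obtain rfl := P.injOn_spine (node_mem_Icc (k + 1)) (Icc_node_subset j hbj) hb
  have h1 := node_strictAnti.le_iff_ge.1 haj.2
  have h2 := node_strictAnti.le_iff_ge.1 hbj.1
  obtain rfl : j = k := by omega
  exact hj

lemma isMarked_iff (hK : ∀ k, k ∈ K ∨ ∃ j ∈ K, k = j + 1) {x : P.Carrier} :
    IsMarked P.vertex x ↔ ∃ k, x = P.spine (node k) := by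
  constructor
  · rintro ⟨⟨z, hz⟩, h⟩
    obtain ⟨a, b, -, rfl, rfl, k, hk, ha, -⟩ := P.exists_of_entangled hz
    by_contra hne
    push Not at hne
    refine h (P.spine (node (k + 1))) (P.spine (node k)) (hne _).symm (hne _).symm ?_ ?_
      (P.entangled_spine hk (left_mem_Icc_node k) (right_mem_Icc_node k) (node_succ_ne k))
    · exact (P.precedes_spine_iff (node_mem_Icc _) (Icc_node_subset k ha)).2 ha.1
    · exact (P.precedes_spine_iff (Icc_node_subset k ha) (node_mem_Icc _)).2 ha.2
  · rintro ⟨k, rfl⟩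
    refine ⟨?_, fun z w hz hw hzk hkw hzw => ?_⟩
    · rcases hK k with hk | ⟨j, hj, rfl⟩
      · exact ⟨_, P.entangled_spine_node_iff.2 hk⟩
      · exact ⟨_, Entangled.symm (P.entangled_spine_node_iff.2 hj)⟩
    · obtain ⟨a, b, -, rfl, rfl, j, -, ha, hb⟩ := P.exists_of_entangled hzw
      have hak := (P.precedes_spine_iff (Icc_node_subset j ha) (node_mem_Icc k)).1 hzk
      have hkb := (P.precedes_spine_iff (node_mem_Icc k) (Icc_node_subset j hb)).1 hkw
      have hak' := lt_of_le_of_ne hak fun h => hz (by rw [h])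
      have hkb' := lt_of_le_of_ne hkb fun h => hw (by rw [h])
      have h1 := node_strictAnti.lt_iff_gt.1 (ha.1.trans_lt hak')
      have h2 := node_strictAnti.lt_iff_gt.1 (hkb'.trans_le hb.2)
      omega

lemma precedes_spine_node_iff {j k : ℕ} :
    Precedes P.vertex (P.spine (node k)) (P.spine (node j)) ↔ j ≤ k := by
  rw [P.precedes_spine_iff (node_mem_Icc k) (node_mem_Icc j), node_strictAnti.le_iff_ge]

lemma eq_of_homeomorph {K L : Set ℕ} (P : FoldPattern K) (Q : FoldPattern L)
    (hK : ∀ k, k ∈ K ∨ ∃ j ∈ K, k = j + 1) (hL : ∀ k, k ∈ L ∨ ∃ j ∈ L, k = j + 1)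
    (φ : P.Carrier ≃ₜ Q.Carrier) : K = L := by
  have hφ := P.map_vertex Q φ
  have hmark : ∀ x, IsMarked Q.vertex (φ x) ↔ IsMarked P.vertex x := fun x => by
    rw [← hφ, isMarked_homeomorph_iff]
  choose σ hσ using fun k => (Q.isMarked_iff hL).1 ((hmark _).2 ((P.isMarked_iff hK).2 ⟨k, rfl⟩))
  have hle : ∀ {j k}, σ j ≤ σ k ↔ j ≤ k := by
    intro j k
    rw [← Q.precedes_spine_node_iff, ← hσ, ← hσ, ← hφ, precedes_homeomorph_iff,
      P.precedes_spine_node_iff]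
  have hsurj : Function.Surjective σ := by
    intro m
    obtain ⟨x, hx⟩ := φ.surjective (Q.spine (node m))
    obtain ⟨k, rfl⟩ := (P.isMarked_iff hK).1 ((hmark x).1 (hx ▸ (Q.isMarked_iff hL).2 ⟨m, rfl⟩))
    refine ⟨k, node_strictAnti.injective (Q.injOn_spine (node_mem_Icc _) (node_mem_Icc _) ?_)⟩
    rw [← hσ, hx]
  have hid : ∀ k, σ k = k := fun k => DFunLike.congr_fun (Subsingleton.elim
    (RelIso.ofSurjective (OrderEmbedding.ofMapLEIff σ fun _ _ => hle) hsurj)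
    (OrderIso.refl ℕ)) k
  ext k
  rw [← P.entangled_spine_node_iff, ← Q.entangled_spine_node_iff, ← entangled_homeomorph_iff φ, hφ,
    hσ, hσ, hid, hid]

end FoldPattern

/-- The even numbers together with the numbers `2 * n + 1` for `n` in `A`. -/
def evenUnion (A : Set ℕ) : Set ℕ := {k | Even k ∨ k / 2 ∈ A}

lemma mem_evenUnion_or (A : Set ℕ) (k : ℕ) :
    k ∈ evenUnion A ∨ ∃ j ∈ evenUnion A, k = j + 1 := by
  rcases Nat.even_or_odd k with h | ⟨j, rfl⟩
  · exact Or.inl (Or.inl h)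
  · exact Or.inr ⟨2 * j, Or.inl (even_two_mul j), rfl⟩

lemma evenUnion_injective : Function.Injective evenUnion := by
  have h : ∀ (A : Set ℕ) n, 2 * n + 1 ∈ evenUnion A ↔ n ∈ A := fun A n => by
    have h1 : ¬Even (2 * n + 1) := Nat.not_even_iff_odd.2 ⟨n, rfl⟩
    have h2 : (2 * n + 1) / 2 = n := by omega
    simp only [evenUnion, mem_ofPred_eq, h1, h2, false_or]
  intro A B hAB
  ext n
  rw [← h A, ← h B, hAB]

/-- There is an uncountable family of pairwise non-homeomorphic Lelek-like fans. -/
theorem statement2 :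
    ∃ (Λ : Type) (X : Λ → Type) (m : ∀ l : Λ, MetricSpace (X l)),
      ¬ Countable Λ ∧
      (∀ l : Λ, letI := m l; IsLelekLikeFan (X l)) ∧
      (∀ l₁ l₂ : Λ, l₁ ≠ l₂ →
        letI := m l₁; letI := m l₂
        IsEmpty ((X l₁) ≃ₜ (X l₂))) := by
  have h0 : ∀ A, 0 ∈ evenUnion A := fun A => Or.inl Even.zero
  let P : ∀ A, FoldPattern (evenUnion A) := fun A => (FoldPattern.nonempty (h0 A)).some
  refine ⟨Set ℕ, fun A => (P A).Carrier,
    fun A => TopologicalSpace.metrizableSpaceMetric (P A).Carrier, ?_,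
    fun A => (P A).isLelekLikeFan (h0 A), fun A B hAB => ⟨fun φ => hAB ?_⟩⟩
  · rintro ⟨f, hf⟩
    exact Function.cantor_injective f hf
  · exact evenUnion_injective
      ((P A).eq_of_homeomorph (P B) (mem_evenUnion_or A) (mem_evenUnion_or B) φ)
end

section
/- Let F be a non-degenerate fan (a fan with more than one point). Then there exist a fan X and a topological embedding e : F → X such that NS(X) = e(F), i.e., the set of non-smooth points of X is exactly the embedded copy of F. -/
open Set Filter Topology

/-- `A` is the (unique) arc in the fan joining `x` and `y`, where `[x,x] = {x}`. -/
def ArcConn {X : Type} [TopologicalSpace X] (A : Set X) (x y : X) : Prop :=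
  (x = y ∧ A = {x}) ∨ (x ≠ y ∧ IsArcEndpoint A x ∧ IsArcEndpoint A y)

/-- `x` is a non-smooth point of a fan with top `v`: there is a sequence `(xₙ)` of pairwise
distinct points converging to `x` such that the arcs `[v,xₙ]` do not converge to `[v,x]`
in the Hausdorff metric. -/
def NSPoint {X : Type} [MetricSpace X] (v x : X) : Prop :=
  ∃ xs : ℕ → X,
    (∀ m n : ℕ, m ≠ n → xs m ≠ xs n) ∧
    Filter.Tendsto xs Filter.atTop (nhds x) ∧
    ∃ (As : ℕ → Set X) (A₀ : Set X),
      (∀ n, ArcConn (As n) v (xs n)) ∧ ArcConn A₀ v x ∧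
      ¬ Filter.Tendsto (fun n => EMetric.hausdorffEdist (As n) A₀) Filter.atTop (nhds 0)

/-- The set of non-smooth points of a fan with top `v`. -/
def NS (X : Type) [MetricSpace X] (v : X) : Set X := {x | NSPoint v x}

/-- A fan with top `v` is smooth if whenever `xₙ → x`, the arcs `[v,xₙ]` converge to
`[v,x]` in the Hausdorff metric. -/
def SmoothFan (X : Type) [MetricSpace X] (v : X) : Prop :=
  ∀ (x : X) (xs : ℕ → X), Filter.Tendsto xs Filter.atTop (nhds x) →
    ∀ (As : ℕ → Set X) (A₀ : Set X),
      (∀ n, ArcConn (As n) v (xs n)) → ArcConn A₀ v x →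
      Filter.Tendsto (fun n => EMetric.hausdorffEdist (As n) A₀) Filter.atTop (nhds 0)

/-- A Lelek fan: a smooth fan with top `v` and a dense set of end-points. -/
def IsLelekFan (X : Type) [MetricSpace X] (v : X) : Prop :=
  IsFan X ∧ IsFanTop v ∧ SmoothFan X v ∧ Dense (DendroidEndpoints X)

open unitInterval

/-- Injective curves `ℓ i` issuing from the common point `x` and pairwise disjoint elsewhere. -/
structure IsStar {ι X : Type} [TopologicalSpace X] (ℓ : ι → I → X) (x : X) : Prop where
  cont : ∀ i, Continuous (ℓ i)
  zero : ∀ i, ℓ i 0 = x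
  inj : ∀ {i j s t}, ℓ i s = ℓ j t → s = t ∧ (s = 0 ∨ i = j)

namespace IsStar

variable {ι κ X Y : Type} [TopologicalSpace X] [TopologicalSpace Y] {ℓ : ι → I → X} {x : X}

lemma comp (h : IsStar ℓ x) {f : X → Y} {S : Set X} (hf : ContinuousOn f S) (hinj : InjOn f S)
    (hS : ∀ i t, ℓ i t ∈ S) : IsStar (fun i t => f (ℓ i t)) (f x) where
  cont i := hf.comp_continuous (h.cont i) (hS i)
  zero _ := by rw [h.zero]
  inj hij := h.inj (hinj (hS _ _) (hS _ _) hij)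

lemma reindex (h : IsStar ℓ x) {g : κ → ι} (hg : Function.Injective g) :
    IsStar (fun i t => ℓ (g i) t) x where
  cont _ := h.cont _
  zero _ := h.zero _
  inj hij := (h.inj hij).imp_right (Or.imp_right fun e => hg e)

lemma shrink (h : IsStar ℓ x) {δ : I} (hδ : δ ≠ 0) : IsStar (fun i t => ℓ i (δ * t)) x where
  cont i := (h.cont i).comp (by fun_prop)
  zero i := by simpa using h.zero i
  inj hij := by
    obtain ⟨h1, h2⟩ := h.inj hij
    exact ⟨mul_left_cancel₀ hδ h1, h2.imp_left fun e => (mul_eq_zero.1 e).resolve_left hδ⟩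

lemma isPreconnected (h : IsStar ℓ x) : IsPreconnected (⋃ i, range (ℓ i)) := by
  rw [← sUnion_range]
  refine isPreconnected_sUnion x _ ?_ ?_
  · rintro _ ⟨i, rfl⟩
    exact ⟨0, h.zero i⟩
  · rintro _ ⟨i, rfl⟩
    exact isPreconnected_range (h.cont i)

/-- A point different from the centre of a star can be avoided by shrinking the star. -/
lemma exists_shrink_ne (h : IsStar ℓ x) {v : X} (hv : x ≠ v) :
    ∃ δ : I, δ ≠ 0 ∧ ∀ i t, ℓ i (δ * t) ≠ v := by
  by_cases hex : ∃ i t, ℓ i t = v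
  · obtain ⟨i, t, rfl⟩ := hex
    have ht : t ≠ 0 := by
      rintro rfl
      exact hv (h.zero i).symm
    have ht' : 0 < (t : ℝ) := unitInterval.pos_iff_ne_zero.2 ht
    refine ⟨⟨t / 2, by linarith [t.2.1], by linarith [t.2.2]⟩, ?_, ?_⟩
    · intro h0
      have := congrArg Subtype.val h0
      simp at this
      exact ht this
    · intro j s hs
      have h1 := congrArg Subtype.val (h.inj hs).1
      simp only [Icc.coe_mul] at h1
      nlinarith [s.2.2, s.2.1]
  · push Not at hex
    exact ⟨1, one_ne_zero, fun i t => hex i _⟩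

end IsStar

lemma not_disjoint_curves_above {f g : I → ℝ} (hf : Continuous f) (hg : Continuous g)
    (h0 : f 0 = g 0) (hf1 : f 0 ≤ f 1) (hg1 : g 0 ≤ g 1)
    (hfg : ∀ s t, f s = g t → s = 0 ∧ t = 0) : False := by
  rcases le_total (f 1) (g 1) with h | h
  · obtain ⟨t, -, ht⟩ := intermediate_value_Icc (zero_le_one (α := I)) hg.continuousOn
      ⟨h0 ▸ hf1, h⟩
    exact one_ne_zero (hfg 1 t ht.symm).1
  · obtain ⟨t, -, ht⟩ := intermediate_value_Icc (zero_le_one (α := I)) hf.continuousOn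
      ⟨h0 ▸ hg1, h⟩
    exact one_ne_zero (hfg t 1 ht).2

lemma IsStar.eq_zero_of_ne {ι X : Type} [TopologicalSpace X] {ℓ : ι → I → X} {x : X}
    (h : IsStar ℓ x) {i j : ι} (hij : i ≠ j) {s t : I} (hst : ℓ i s = ℓ j t) : s = 0 ∧ t = 0 := by
  obtain ⟨rfl, h2⟩ := h.inj hst
  simpa using h2.resolve_right hij

lemma IsStar.not_above {ι : Type} {ℓ : ι → I → ℝ} {c : ℝ} (h : IsStar ℓ c) {i j : ι}
    (hij : i ≠ j) : ¬ (c ≤ ℓ i 1 ∧ c ≤ ℓ j 1) := fun ⟨hi, hj⟩ =>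
  not_disjoint_curves_above (h.cont i) (h.cont j) (by rw [h.zero, h.zero]) (by rwa [h.zero])
    (by rwa [h.zero]) fun _ _ => h.eq_zero_of_ne hij

lemma not_isStar_three_real {ℓ : Fin 3 → I → ℝ} {c : ℝ} (h : IsStar ℓ c) : False := by
  have h' : IsStar (fun i t => -ℓ i t) (-c) :=
    h.comp (S := univ) continuous_neg.continuousOn neg_injective.injOn (by simp)
  have a1 := h.not_above (i := 0) (j := 1) (by decide)
  have a2 := h.not_above (i := 0) (j := 2) (by decide)
  have a3 := h.not_above (i := 1) (j := 2) (by decide)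
  have b1 := h'.not_above (i := 0) (j := 1) (by decide)
  have b2 := h'.not_above (i := 0) (j := 2) (by decide)
  have b3 := h'.not_above (i := 1) (j := 2) (by decide)
  simp only [neg_le_neg_iff] at b1 b2 b3
  have t0 := le_total c (ℓ 0 1)
  have t1 := le_total c (ℓ 1 1)
  have t2 := le_total c (ℓ 2 1)
  tauto

lemma exists_isStar_two_of_interior {t : I} (h0 : t ≠ 0) (h1 : t ≠ 1) :
    ∃ ℓ : Fin 2 → I → I, IsStar ℓ t := by
  have h0' : 0 < (t : ℝ) := unitInterval.pos_iff_ne_zero.2 h0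
  have h1' : (t : ℝ) < 1 := unitInterval.lt_one_iff_ne_one.2 h1
  refine ⟨![fun s => t * σ s, fun s => σ (σ t * σ s)], ?_, ?_, ?_⟩
  · intro i
    fin_cases i
    · change Continuous fun s => t * σ s
      fun_prop
    · change Continuous fun s => σ (σ t * σ s)
      fun_prop
  · intro i
    fin_cases i <;> simp
  · intro i j s s' h
    have hs := s.2
    have hs' := s'.2
    simp only [mem_Icc] at hs hs'
    have aux : (t : ℝ) * (1 - s) = 1 - (1 - t) * (1 - s') → (s : ℝ) = 0 ∧ (s' : ℝ) = 0 :=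
      fun _ => by constructor <;> nlinarith
    have aux' : (t : ℝ) * (1 - s') = 1 - (1 - t) * (1 - s) → (s : ℝ) = 0 ∧ (s' : ℝ) = 0 :=
      fun _ => by constructor <;> nlinarith
    replace h := congrArg Subtype.val h
    fin_cases i <;> fin_cases j
    · have h2 : (t : ℝ) * (1 - s) = t * (1 - s') := h
      exact ⟨Subtype.ext (by linarith [mul_left_cancel₀ h0'.ne' h2]), Or.inr rfl⟩
    · obtain ⟨e, e'⟩ := aux h
      exact ⟨Subtype.ext (e.trans e'.symm), Or.inl (Subtype.ext e)⟩
    · obtain ⟨e, e'⟩ := aux' h.symm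
      exact ⟨Subtype.ext (e.trans e'.symm), Or.inl (Subtype.ext e)⟩
    · have h2 : 1 - (1 - (t : ℝ)) * (1 - s) = 1 - (1 - t) * (1 - s') := h
      have h3 : (1 - (t : ℝ)) * (1 - s) = (1 - t) * (1 - s') := by linarith
      exact ⟨Subtype.ext (by linarith [mul_left_cancel₀ (by linarith) h3]), Or.inr rfl⟩

section Arcs

variable {X : Type} [TopologicalSpace X]

/-- An injective curve from `x` to `y`. -/
structure IsArcCurve (φ : I → X) (x y : X) : Prop where
  cont : Continuous φ
  inj : Function.Injective φ
  zero : φ 0 = x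
  one : φ 1 = y

lemma IsArcCurve.symm {φ : I → X} {x y : X} (h : IsArcCurve φ x y) :
    IsArcCurve (fun t => φ (σ t)) y x where
  cont := h.cont.comp continuous_symm
  inj := h.inj.comp symm_bijective.injective
  zero := by simpa using h.one
  one := by simpa using h.zero

lemma IsArcCurve.comp {Y : Type} [TopologicalSpace Y] {φ : I → X} {x y : X}
    (h : IsArcCurve φ x y) {f : X → Y} (hf : Continuous f) (hinj : Function.Injective f) :
    IsArcCurve (fun t => f (φ t)) (f x) (f y) where
  cont := hf.comp h.cont
  inj := hinj.comp h.inj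
  zero := by rw [h.zero]
  one := by rw [h.one]

lemma isArcEndpoint_range [T2Space X] {φ : I → X} (hφ : Continuous φ)
    (hinj : Function.Injective φ) : IsArcEndpoint (range φ) (φ 0) :=
  ⟨(hφ.isClosedEmbedding hinj).isEmbedding.toHomeomorph, rfl⟩

lemma IsArcCurve.isArcEndpoint_left [T2Space X] {φ : I → X} {x y : X} (h : IsArcCurve φ x y) :
    IsArcEndpoint (range φ) x := by
  simpa [h.zero] using isArcEndpoint_range h.cont h.inj

lemma IsArcCurve.isArcEndpoint_right [T2Space X] {φ : I → X} {x y : X}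
    (h : IsArcCurve φ x y) : IsArcEndpoint (range φ) y := by
  have := h.symm.isArcEndpoint_left
  rwa [show range (fun t => φ (σ t)) = range φ from symm_bijective.surjective.range_comp φ] at this

lemma IsArcCurve.ne {φ : I → X} {x y : X} (h : IsArcCurve φ x y) : x ≠ y := by
  rw [← h.zero, ← h.one]
  exact h.inj.ne zero_ne_one

lemma IsArcCurve.arcConn [T2Space X] {φ : I → X} {x y : X} (h : IsArcCurve φ x y) :
    ArcConn (range φ) x y :=
  Or.inr ⟨h.ne, h.isArcEndpoint_left, h.isArcEndpoint_right⟩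

/-- An end-point of an arc is not the centre of a two-legged star inside the arc. -/
lemma IsArcEndpoint.not_isStar_two {A : Set X} {x : X} (hA : IsArcEndpoint A x)
    {ℓ : Fin 2 → I → X} (h : IsStar ℓ x) (hℓ : ∀ i t, ℓ i t ∈ A) : False := by
  obtain ⟨e, he⟩ := hA
  have h' : IsStar (fun i t => ((e.symm ⟨ℓ i t, hℓ i t⟩ : I) : ℝ)) 0 := by
    refine ⟨fun i => ?_, fun i => ?_, fun {i j s t} hij => ?_⟩
    · exact continuous_subtype_val.comp (e.symm.continuous.comp ((h.cont i).subtype_mk _))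
    · have : (⟨ℓ i 0, hℓ i 0⟩ : A) = e 0 := Subtype.ext ((h.zero i).trans he.symm)
      rw [this, e.symm_apply_apply]
      rfl
    · exact h.inj (congrArg Subtype.val (e.symm.injective (Subtype.ext hij)))
  exact h'.not_above (i := 0) (j := 1) (by decide) ⟨unitInterval.nonneg _, unitInterval.nonneg _⟩

lemma exists_isArcCurve {A : Set X} {x y : X} (hx : IsArcEndpoint A x) (hy : IsArcEndpoint A y)
    (hxy : x ≠ y) : ∃ φ, IsArcCurve φ x y ∧ range φ = A := by
  obtain ⟨e, he⟩ := hx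
  have hyA : y ∈ A := by
    obtain ⟨e', he'⟩ := hy
    exact he' ▸ Subtype.prop _
  set φ : I → X := fun t => e t with hφ
  have hc : Continuous φ := continuous_subtype_val.comp e.continuous
  have hi : Function.Injective φ := Subtype.val_injective.comp e.injective
  have hr : range φ = A := by
    rw [hφ, show (fun t => (e t : X)) = Subtype.val ∘ e from rfl, e.surjective.range_comp,
      Subtype.range_coe]
  refine ⟨φ, ⟨hc, hi, he, ?_⟩, hr⟩
  obtain ⟨t, rfl⟩ : y ∈ range φ := hr ▸ hyA
  by_contra h1
  obtain ⟨ℓ, hℓ⟩ := exists_isStar_two_of_interior (t := t) (fun h => hxy (h ▸ he.symm))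
    (fun h => h1 (h ▸ rfl))
  exact hy.not_isStar_two (hℓ.comp (S := univ) hc.continuousOn hi.injOn (by simp))
    fun i s => hr ▸ mem_range_self _

/-- Two arcs with exactly one end-point in common can be concatenated. -/
lemma IsArcCurve.trans {φ ψ : I → X} {x y z : X} (h : IsArcCurve φ x y) (h' : IsArcCurve ψ y z)
    (hd : ∀ s t, φ s = ψ t → t = 0) : ∃ χ, IsArcCurve χ x z := by
  let γ : Path x y := ⟨⟨φ, h.cont⟩, h.zero, h.one⟩
  let γ' : Path y z := ⟨⟨ψ, h'.cont⟩, h'.zero, h'.one⟩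
  refine ⟨γ.trans γ', (γ.trans γ').continuous, ?_, (γ.trans γ').source, (γ.trans γ').target⟩
  intro s t hst
  rw [Path.trans_apply, Path.trans_apply] at hst
  split_ifs at hst with h1 h2 h2
  · have := congrArg Subtype.val (h.inj hst)
    simp only at this
    exact Subtype.ext (by linarith)
  · have := congrArg Subtype.val (hd _ _ hst)
    simp only [Icc.coe_zero] at this
    linarith
  · have := congrArg Subtype.val (hd _ _ hst.symm)
    simp only [Icc.coe_zero] at this
    linarith
  · have := congrArg Subtype.val (h'.inj hst)
    simp only at this
    exact Subtype.ext (by linarith)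

end Arcs

lemma exists_isArcCurve_unitInterval {a b : I} (hab : a ≠ b) : ∃ φ, IsArcCurve φ a b := by
  have hc : Continuous fun s : I => ((1 - s) * a + s * b : ℝ) := by fun_prop
  have ha := a.2
  have hb := b.2
  simp only [mem_Icc] at ha hb
  refine ⟨fun s => ⟨(1 - s) * a + s * b, ?_, ?_⟩, hc.subtype_mk _, ?_, by simp, by simp⟩
  · nlinarith [s.2.1, s.2.2]
  · nlinarith [s.2.1, s.2.2]
  · intro s t hst
    have h1 := congrArg Subtype.val hst
    simp only at h1
    have h2 : ((s : ℝ) - t) * (b - a) = 0 := by linarith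
    rcases mul_eq_zero.1 h2 with h3 | h3
    · exact Subtype.ext (by linarith)
    · exact absurd (Subtype.ext (by linarith)) hab

section Ramification

variable {X : Type} [TopologicalSpace X] {x : X}

lemma IsRamificationPoint.exists_isStar (h : IsRamificationPoint x) :
    ∃ ℓ : Fin 3 → I → X, IsStar ℓ x := by
  obtain ⟨T, e, he⟩ := h
  let leg : Fin 3 → I → TSet := ![
    fun t => ⟨((t : ℝ), 0), Or.inl ⟨⟨by linarith [t.2.1], t.2.2⟩, rfl⟩⟩,
    fun t => ⟨(-(t : ℝ), 0), Or.inl ⟨⟨by linarith [t.2.2], by linarith [t.2.1]⟩, rfl⟩⟩,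
    fun t => ⟨(0, (t : ℝ)), Or.inr ⟨rfl, t.2⟩⟩]
  refine ⟨fun i t => e (leg i t), fun i => ?_, fun i => ?_, fun {i j s t} hij => ?_⟩
  · refine continuous_subtype_val.comp (e.continuous.comp ?_)
    rw [continuous_induced_rng]
    fin_cases i
    · change Continuous fun t : I => ((t : ℝ), (0 : ℝ))
      fun_prop
    · change Continuous fun t : I => (-(t : ℝ), (0 : ℝ))
      fun_prop
    · change Continuous fun t : I => ((0 : ℝ), (t : ℝ))
      fun_prop
  · rw [← he]
    congr 2
    fin_cases i <;> simp [leg]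
  · have h1 := congrArg Subtype.val (e.injective (Subtype.ext hij))
    have hs := s.2.1
    have ht := t.2.1
    have same : (s : ℝ) = t → s = t := fun h => Subtype.ext h
    have zero : (s : ℝ) = 0 → (t : ℝ) = 0 → s = t ∧ s = 0 := fun h h' =>
      ⟨Subtype.ext (h.trans h'.symm), Subtype.ext h⟩
    fin_cases i <;> fin_cases j <;> simp [leg, -Icc.coe_eq_zero] at h1 ⊢
    · exact Subtype.ext h1
    · exact zero (by linarith) (by linarith)
    · exact zero h1.1 h1.2.symm
    · exact zero (by linarith) (by linarith)
    · exact Subtype.ext h1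
    · exact zero h1.1 h1.2.symm
    · exact zero h1.2 h1.1.symm
    · exact zero h1.2 h1.1
    · exact Subtype.ext h1

lemma IsStar.isRamificationPoint [T2Space X] {ℓ : Fin 3 → I → X} (h : IsStar ℓ x) :
    IsRamificationPoint x := by
  let pr : ℝ → I := projIcc 0 1 zero_le_one
  have hpr : Continuous pr := continuous_projIcc
  have pr0 : pr 0 = 0 := projIcc_left _
  let g : TSet → X := fun z =>
    if z.1.2 ≤ |z.1.1| then (if 0 ≤ z.1.1 then ℓ 0 (pr z.1.1) else ℓ 1 (pr (-z.1.1)))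
    else ℓ 2 (pr z.1.2)
  have hT : ∀ z : TSet, -1 ≤ z.1.1 ∧ z.1.1 ≤ 1 ∧ 0 ≤ z.1.2 ∧ z.1.2 ≤ 1 ∧
      (z.1.1 = 0 ∨ z.1.2 = 0) := by
    rintro ⟨⟨a, b⟩, ⟨⟨h1, h2⟩, h3⟩ | ⟨h1, h2, h3⟩⟩
    · have hb : b = 0 := h3
      exact ⟨h1, h2, hb.ge, hb.le.trans zero_le_one, Or.inr hb⟩
    · have ha : a = 0 := h1
      refine ⟨?_, ?_, h2, h3, Or.inl ha⟩ <;> simp [ha]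
  have hgc : Continuous g := by
    have c0 := h.cont 0
    have c1 := h.cont 1
    have c2 := h.cont 2
    refine Continuous.if_le (Continuous.if_le ?_ ?_ ?_ ?_ ?_) ?_ ?_ ?_ ?_
    · fun_prop
    · fun_prop
    · fun_prop
    · fun_prop
    · intro z hz
      rw [← hz, neg_zero, pr0, h.zero, h.zero]
    · fun_prop
    · fun_prop
    · fun_prop
    · intro z hz
      have : z.1.1 = 0 ∧ z.1.2 = 0 := by
        rcases (hT z).2.2.2.2 with h0 | h0
        · exact ⟨h0, by rw [hz, h0, abs_zero]⟩
        · exact ⟨abs_eq_zero.1 (hz.symm.trans h0), h0⟩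
      rw [this.1, this.2, if_pos le_rfl, pr0, h.zero, h.zero]
  have hgi : Function.Injective g := by
    let P : Fin 3 → I → ℝ × ℝ := ![fun t => (t, 0), fun t => (-t, 0), fun t => (0, t)]
    have P0 : ∀ i, P i 0 = 0 := by
      intro i
      fin_cases i <;> simp [P]
    have key : ∀ z : TSet, ∃ i t, g z = ℓ i t ∧ z.1 = P i t := by
      intro z
      obtain ⟨h1, h2, h3, h4, h5⟩ := hT z
      by_cases hle : z.1.2 ≤ |z.1.1|
      · have hb : z.1.2 = 0 := h5.elim (fun h0 => le_antisymm (by simpa [h0] using hle) h3) id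
        by_cases ha : 0 ≤ z.1.1
        · exact ⟨0, ⟨z.1.1, ha, h2⟩, by simp only [g, if_pos hle, if_pos ha, pr,
            projIcc_of_mem zero_le_one (show z.1.1 ∈ Icc (0 : ℝ) 1 from ⟨ha, h2⟩)],
            Prod.ext rfl hb⟩
        · have hm : -z.1.1 ∈ Icc (0 : ℝ) 1 := ⟨by linarith, by linarith⟩
          exact ⟨1, ⟨_, hm⟩, by simp only [g, if_pos hle, if_neg ha, pr,
            projIcc_of_mem zero_le_one hm], Prod.ext (neg_neg _).symm hb⟩
      · have ha : z.1.1 = 0 := h5.resolve_right fun h0 => hle (h0 ▸ abs_nonneg _)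
        exact ⟨2, ⟨z.1.2, h3, h4⟩, by simp only [g, if_neg hle, pr,
          projIcc_of_mem zero_le_one (show z.1.2 ∈ Icc (0 : ℝ) 1 from ⟨h3, h4⟩)],
          Prod.ext ha rfl⟩
    intro z w hzw
    obtain ⟨i, t, hz, hz'⟩ := key z
    obtain ⟨j, s, hw, hw'⟩ := key w
    refine Subtype.ext ?_
    rw [hz', hw']
    obtain ⟨rfl, rfl | rfl⟩ := h.inj (hz.symm.trans (hzw.trans hw))
    · rw [P0, P0]
    · rfl
  have : CompactSpace TSet := by
    refine isCompact_iff_compactSpace.1 ?_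
    exact (isCompact_Icc.prod isCompact_singleton).union (isCompact_singleton.prod isCompact_Icc)
  refine ⟨range g, (hgc.isClosedEmbedding hgi).isEmbedding.toHomeomorph, ?_⟩
  change g _ = x
  simp [g, pr0, h.zero]

end Ramification

/-- Closed connected sets have connected (possibly empty) intersections. -/
def ConnectedInters (X : Type) [TopologicalSpace X] : Prop :=
  ∀ A B : Set X, IsClosed A → IsClosed B → IsPreconnected A → IsPreconnected B →
    IsPreconnected (A ∩ B)

section Unicoherence

variable {X : Type} [TopologicalSpace X]

lemma HereditarilyUnicoherent.connectedInters [CompactSpace X] (h : HereditarilyUnicoherent X) :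
    ConnectedInters X := by
  intro A B hA hB hA' hB'
  rcases (A ∩ B).eq_empty_or_nonempty with h0 | h0
  · rw [h0]
    exact isPreconnected_empty
  · have cA : IsConnected A := ⟨h0.mono inter_subset_left, hA'⟩
    have cB : IsConnected B := ⟨h0.mono inter_subset_right, hB'⟩
    exact (h _ A B ⟨hA.isCompact.union hB.isCompact, cA.union h0 cB⟩ ⟨hA.isCompact, cA⟩
      ⟨hB.isCompact, cB⟩ rfl).isPreconnected

lemma ConnectedInters.hereditarilyUnicoherent [T2Space X] (h : ConnectedInters X) :
    HereditarilyUnicoherent X := by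
  rintro C A B hC ⟨hA, cA⟩ ⟨hB, cB⟩ rfl
  refine ⟨?_, h A B hA.isClosed hB.isClosed cA.isPreconnected cB.isPreconnected⟩
  have := isPreconnected_closed_iff.1 hC.2.isPreconnected A B hA.isClosed hB.isClosed le_rfl
    (cA.nonempty.mono fun z hz => ⟨Or.inl hz, hz⟩) (cB.nonempty.mono fun z hz => ⟨Or.inr hz, hz⟩)
  exact this.mono inter_subset_right

lemma connectedInters_unitInterval : ConnectedInters I := fun _ _ _ _ hA hB =>
  isPreconnected_iff_ordConnected.2 (hA.ordConnected.inter hB.ordConnected)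

/-- Connectedness of an intersection inside the range of a closed embedding. -/
lemma ConnectedInters.inter_range {Y : Type} [TopologicalSpace Y] (h : ConnectedInters Y)
    {f : Y → X} (hf : IsClosedEmbedding f) {A B : Set X} (hA : IsClosed A) (hB : IsClosed B)
    (cA : IsPreconnected (A ∩ range f)) (cB : IsPreconnected (B ∩ range f)) :
    IsPreconnected (A ∩ B ∩ range f) := by
  have key : ∀ {C : Set X}, IsPreconnected (C ∩ range f) → IsPreconnected (f ⁻¹' C) := by
    intro C hC
    rw [← preimage_inter_range]
    exact hC.preimage_of_isClosedMap hf.injective hf.isClosedMap inter_subset_right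
  have := (h _ _ (hA.preimage hf.continuous) (hB.preimage hf.continuous) (key cA)
    (key cB)).image f hf.continuous.continuousOn
  rwa [← preimage_inter, image_preimage_eq_inter_range] at this

lemma ConnectedInters.range_subset [T2Space X] (h : ConnectedInters X) {φ ψ : I → X} {x y : X}
    (hφ : IsArcCurve φ x y) (hψ : IsArcCurve ψ x y) : range φ ⊆ range ψ := by
  have hcl : IsClosedEmbedding φ := hφ.cont.isClosedEmbedding hφ.inj
  have := h _ _ hcl.isClosed_range (hψ.cont.isClosedEmbedding hψ.inj).isClosed_range
    (isPreconnected_range hφ.cont) (isPreconnected_range hψ.cont)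
  have hpre := this.preimage_of_isClosedMap hφ.inj hcl.isClosedMap inter_subset_left
  rintro _ ⟨t, rfl⟩
  exact (hpre.ordConnected.out
    (x := 0) ⟨mem_range_self 0, by rw [hφ.zero, ← hψ.zero]; exact mem_range_self 0⟩
    (y := 1) ⟨mem_range_self 1, by rw [hφ.one, ← hψ.one]; exact mem_range_self 1⟩
    ⟨unitInterval.nonneg t, unitInterval.le_one t⟩).2

lemma ConnectedInters.eq_range [T2Space X] (h : ConnectedInters X) {A : Set X} {φ : I → X}
    {x y : X} (hA : ArcConn A x y) (hφ : IsArcCurve φ x y) : A = range φ := by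
  rcases hA with ⟨rfl, -⟩ | ⟨hxy, hx, hy⟩
  · exact absurd rfl hφ.ne
  · obtain ⟨ψ, hψ, rfl⟩ := exists_isArcCurve hx hy hxy
    exact (h.range_subset hψ hφ).antisymm (h.range_subset hφ hψ)

/-- The intersection of a decreasing sequence of compact connected sets is connected. -/
lemma isPreconnected_iInter_of_antitone [T2Space X] {K : ℕ → Set X} (hK : Antitone K)
    (hcomp : ∀ n, IsCompact (K n)) (hconn : ∀ n, IsPreconnected (K n)) :
    IsPreconnected (⋂ n, K n) := by
  have hc : IsCompact (⋂ n, K n) := (hcomp 0).of_isClosed_subset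
    (isClosed_iInter fun n => (hcomp n).isClosed) (iInter_subset K 0)
  rw [isPreconnected_iff_subset_of_fully_disjoint_closed hc.isClosed]
  intro u v hu hv huv hd
  obtain ⟨U, V, hU, hV, hUu, hVv, hUV⟩ := SeparatedNhds.of_isCompact_isCompact
    (hc.inter_right hu) (hc.inter_right hv) (hd.mono inter_subset_right inter_subset_right)
  obtain ⟨n, hn⟩ := exists_subset_nhds_of_isCompact' (U := U ∪ V) hK.directed_ge hcomp
    (fun n => (hcomp n).isClosed) fun z hz => (hU.union hV).mem_nhds
      ((huv hz).imp (fun h => hUu ⟨hz, h⟩) fun h => hVv ⟨hz, h⟩)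
  rcases (hconn n).subset_or_subset hU hV hUV hn with h | h
  · refine Or.inl fun z hz => (huv hz).resolve_right fun hzv => ?_
    exact disjoint_left.1 hUV (h (iInter_subset K n hz)) (hVv ⟨hz, hzv⟩)
  · refine Or.inr fun z hz => (huv hz).resolve_left fun hzu => ?_
    exact disjoint_left.1 hUV (hUu ⟨hz, hzu⟩) (h (iInter_subset K n hz))

end Unicoherence

section NonSmooth

variable {X : Type} [MetricSpace X]

lemma nsPoint_of_curves {v x y : X} {a : ℕ → I → X} {m : I} {A₀ : Set X}
    (ha : ∀ k, IsArcCurve (a k) v (a k 1)) (hdist : Function.Injective fun k => a k 1)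
    (hx : Tendsto (fun k => a k 1) atTop (𝓝 x)) (hy : Tendsto (fun k => a k m) atTop (𝓝 y))
    (hA₀ : ArcConn A₀ v x) (hcl : IsClosed A₀) (hyA : y ∉ A₀) : NSPoint v x := by
  refine ⟨fun k => a k 1, fun i j hij => hdist.ne hij, hx, fun k => range (a k), A₀,
    fun k => (ha k).arcConn, hA₀, fun hlim => hyA ?_⟩
  have h1 : Tendsto (fun k => Metric.infEDist (a k m) A₀) atTop (𝓝 0) :=
    tendsto_of_tendsto_of_tendsto_of_le_of_le tendsto_const_nhds hlim (fun _ => bot_le)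
      fun k => Metric.infEDist_le_hausdorffEDist_of_mem (mem_range_self m)
  have h2 : Tendsto (fun k => Metric.infEDist (a k m) A₀) atTop (𝓝 (Metric.infEDist y A₀)) :=
    (Metric.continuous_infEDist.tendsto y).comp hy
  rw [← hcl.closure_eq, Metric.mem_closure_iff_infEDist_zero]
  exact tendsto_nhds_unique h2 h1

lemma not_nsPoint_of_retract (hX : ConnectedInters X) {v x : X} {α : I → X} (hα : Continuous α)
    (hinj : Function.Injective α) (h0 : α 0 = v) {τ : X → I} (hτ : Continuous τ)
    (hτx : τ x ≠ 0) (h : ∀ z, τ z ≠ 0 → α (τ z) = z) : ¬ NSPoint v x := by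
  have harc : ∀ {z : X} {A : Set X}, τ z ≠ 0 → ArcConn A v z →
      A = range fun s => α (τ z * s) := by
    intro z A hz hA
    refine hX.eq_range hA ⟨by fun_prop, fun s t hst => mul_left_cancel₀ hz (hinj hst), ?_, ?_⟩
    · rw [mul_zero, h0]
    · rw [mul_one, h z hz]
  rintro ⟨xs, -, hxs, As, A₀, hAs, hA₀, hlim⟩
  refine hlim ?_
  rw [harc hτx hA₀, ENNReal.tendsto_nhds_zero]
  intro ε hε
  have huc : UniformContinuous α := CompactSpace.uniformContinuous_of_continuous hα
  obtain ⟨δ, hδ, hδε⟩ := EMetric.uniformContinuous_iff.1 huc ε hε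
  have hτs : Tendsto (fun k => τ (xs k)) atTop (𝓝 (τ x)) := (hτ.tendsto x).comp hxs
  filter_upwards [hτs.eventually_ne hτx, hτs.eventually (Metric.eball_mem_nhds _ hδ)]
    with k hk hkδ
  rw [harc hk (hAs k)]
  have key : ∀ s : I, edist (α (τ (xs k) * s)) (α (τ x * s)) ≤ ε := by
    intro s
    refine (hδε (lt_of_le_of_lt ?_ hkδ)).le
    rw [edist_dist, edist_dist]
    refine ENNReal.ofReal_le_ofReal ?_
    rw [Subtype.dist_eq, Subtype.dist_eq, Real.dist_eq, Real.dist_eq, Icc.coe_mul, Icc.coe_mul,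
      ← sub_mul, abs_mul, abs_of_nonneg s.2.1]
    exact mul_le_of_le_one_right (abs_nonneg _) s.2.2
  refine Metric.hausdorffEDist_le_of_mem_edist ?_ ?_
  · rintro _ ⟨s, rfl⟩
    exact ⟨_, mem_range_self s, key s⟩
  · rintro _ ⟨s, rfl⟩
    exact ⟨_, mem_range_self s, by rw [edist_comm]; exact key s⟩

end NonSmooth

/-- A fan has a point lying in the interior of an arc which is its only possible ramification
point. -/
lemma IsFan.exists_centre {F : Type} [TopologicalSpace F] [T2Space F] (hF : IsFan F)
    (hnd : ∃ x y : F, x ≠ y) :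
    ∃ v : F, (∀ x, IsRamificationPoint x → x = v) ∧ ∃ ℓ : Fin 2 → I → F, IsStar ℓ v := by
  by_cases h : ∃ v : F, IsRamificationPoint v
  · obtain ⟨v, hv⟩ := h
    obtain ⟨ℓ, hℓ⟩ := hv.exists_isStar
    exact ⟨v, fun x hx => hF.2 x v hx hv, _, hℓ.reindex (Fin.castSucc_injective 2)⟩
  · obtain ⟨x, y, hxy⟩ := hnd
    obtain ⟨A, hx, hy⟩ := hF.1.2.2.2.2.1 x y hxy
    obtain ⟨φ, hφ, -⟩ := exists_isArcCurve hx hy hxy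
    have hhalf : (⟨1 / 2, by norm_num, by norm_num⟩ : I) ≠ 0 ∧
        (⟨1 / 2, by norm_num, by norm_num⟩ : I) ≠ 1 := by
      constructor <;> intro h <;> have := congrArg Subtype.val h <;> norm_num at this
    obtain ⟨ℓ, hℓ⟩ := exists_isStar_two_of_interior hhalf.1 hhalf.2
    exact ⟨_, fun x hx => absurd ⟨x, hx⟩ h, _,
      hℓ.comp (S := univ) hφ.cont.continuousOn hφ.inj.injOn (by simp)⟩

/-- The fan-like space obtained from `F` by attaching, for every `n`, an arc parametrized by `I`
whose points lie over the points `p n t` of `F`; these arcs accumulate only on `F`. -/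
def hairySet {F : Type} (p : ℕ → I → F) : Set (F × (ℕ → I)) :=
  {z | (∀ m n, m ≠ n → z.2 m = 0 ∨ z.2 n = 0) ∧ ∀ n, z.2 n = 0 ∨ z.1 = p n (z.2 n)}

/-- The set `hairySet p` as a space. -/
abbrev Hairy {F : Type} (p : ℕ → I → F) : Type := hairySet p

namespace Hairy

variable {F : Type} {p : ℕ → I → F}

/-- The height of a point on the `n`-th attached arc. -/
def coord (n : ℕ) (z : Hairy p) : I := z.1.2 n

/-- The inclusion of `F`. -/
def base (p : ℕ → I → F) (x : F) : Hairy p :=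
  ⟨(x, 0), fun _ _ _ => Or.inl rfl, fun _ => Or.inl rfl⟩

/-- The `n`-th attached arc. -/
def hair (p : ℕ → I → F) (n : ℕ) (t : I) : Hairy p :=
  ⟨(p n t, Pi.single n t), fun i j hij => by
    by_cases hi : i = n
    · right
      exact Pi.single_eq_of_ne (fun h => hij (hi.trans h.symm)) _
    · left
      exact Pi.single_eq_of_ne hi _, fun i => by
    by_cases hi : i = n
    · subst hi
      right
      simp
    · left
      exact Pi.single_eq_of_ne hi _⟩

@[simp] lemma coord_base (n : ℕ) (x : F) : coord n (base p x) = 0 := rfl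

@[simp] lemma coord_hair (n : ℕ) (t : I) : coord n (hair p n t) = t := Pi.single_eq_same _ _

lemma coord_hair_of_ne {m n : ℕ} (h : m ≠ n) (t : I) : coord m (hair p n t) = 0 :=
  Pi.single_eq_of_ne h _

lemma coord_eq_zero {z : Hairy p} {m n : ℕ} (hz : coord n z ≠ 0) (h : m ≠ n) : coord m z = 0 :=
  (z.2.1 m n h).resolve_right hz

lemma base_injective : Function.Injective (base p) := fun _ _ h =>
  congrArg (fun z : Hairy p => z.1.1) h

lemma hair_injective (n : ℕ) : Function.Injective (hair p n) := fun s t h => by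
  simpa using congrArg (coord n) h

lemma hair_coord {z : Hairy p} {n : ℕ} (hz : coord n z ≠ 0) : hair p n (coord n z) = z := by
  refine Subtype.ext (Prod.ext ((z.2.2 n).resolve_left hz).symm (funext fun m => ?_))
  by_cases h : m = n
  · subst h
    exact coord_hair (p := p) _ _
  · exact (coord_hair_of_ne (p := p) h _).trans (coord_eq_zero hz h).symm

lemma mem_range_base {z : Hairy p} : z ∈ range (base p) ↔ ∀ n, coord n z = 0 := by
  constructor
  · rintro ⟨x, rfl⟩ n
    rfl
  · intro h
    exact ⟨z.1.1, Subtype.ext (Prod.ext rfl (funext fun n => (h n).symm))⟩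

lemma mem_range_base_or (z : Hairy p) : z ∈ range (base p) ∨ ∃ n, coord n z ≠ 0 := by
  rw [mem_range_base, ← not_forall]
  exact em _

lemma hair_zero {v : F} (h0 : ∀ n, p n 0 = v) (n : ℕ) : hair p n 0 = base p v :=
  Subtype.ext (Prod.ext (h0 n) (Pi.single_zero n))

lemma mem_range_hair {v : F} {z : Hairy p} (h0 : ∀ n, p n 0 = v) {n : ℕ} :
    z ∈ range (hair p n) ↔ coord n z ≠ 0 ∨ z = base p v := by
  constructor
  · rintro ⟨t, rfl⟩
    by_cases ht : t = 0
    · exact Or.inr (ht ▸ hair_zero h0 n)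
    · exact Or.inl (by simpa using ht)
  · rintro (h | rfl)
    · exact ⟨_, hair_coord h⟩
    · exact ⟨0, hair_zero h0 n⟩

variable [TopologicalSpace F]

lemma continuous_coord (n : ℕ) : Continuous (coord (p := p) n) :=
  (continuous_apply n).comp (continuous_snd.comp continuous_subtype_val)

lemma isClosedEmbedding_base [CompactSpace F] [T2Space F] : IsClosedEmbedding (base p) :=
  Continuous.isClosedEmbedding ((continuous_id.prodMk continuous_const).subtype_mk _)
    base_injective

lemma continuous_hair (hp : ∀ n, Continuous (p n)) (n : ℕ) : Continuous (hair p n) :=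
  ((hp n).prodMk (continuous_single (A := fun _ : ℕ => I) n)).subtype_mk _

lemma isClosedEmbedding_hair [T2Space F] (hp : ∀ n, Continuous (p n)) (n : ℕ) :
    IsClosedEmbedding (hair p n) :=
  (continuous_hair hp n).isClosedEmbedding (hair_injective n)

lemma compactSpace [CompactSpace F] [T2Space F] (hp : ∀ n, Continuous (p n)) :
    CompactSpace (Hairy p) := by
  refine isCompact_iff_compactSpace.1 (IsClosed.isCompact ?_)
  have hc : ∀ n, Continuous fun z : F × (ℕ → I) => z.2 n := fun n => by fun_prop
  refine IsClosed.and ?_ ?_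
  · simp only [ofPred_forall]
    exact isClosed_iInter fun m => isClosed_iInter fun n => isClosed_iInter fun _ =>
      (isClosed_eq (hc m) continuous_const).union (isClosed_eq (hc n) continuous_const)
  · simp only [ofPred_forall]
    exact isClosed_iInter fun n => (isClosed_eq (hc n) continuous_const).union
      (isClosed_eq continuous_fst ((hp n).comp (hc n)))

/-- Points on attached arcs of increasing index converge to points of `F` as soon as their
projections do. -/
lemma tendsto_hair {k : ℕ → ℕ} (hk : Tendsto k atTop atTop) {t : ℕ → I} {x : F}
    (h : Tendsto (fun i => p (k i) (t i)) atTop (𝓝 x)) :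
    Tendsto (fun i => hair p (k i) (t i)) atTop (𝓝 (base p x)) := by
  rw [tendsto_subtype_rng]
  refine h.prodMk_nhds (tendsto_pi_nhds.2 fun m => ?_)
  refine tendsto_const_nhds.congr' ?_
  filter_upwards [hk.eventually_gt_atTop m] with i hi
  exact (coord_hair_of_ne (p := p) hi.ne _).symm

section Connectedness

variable {v : F}

lemma isOpen_coord_ne (n : ℕ) : IsOpen {z : Hairy p | coord n z ≠ 0} :=
  isOpen_ne_fun (continuous_coord n) continuous_const

lemma closure_coord_ne_subset [T2Space F] (hp : ∀ n, Continuous (p n)) (n : ℕ) :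
    closure {z : Hairy p | coord n z ≠ 0} ⊆ range (hair p n) :=
  closure_minimal (fun _ hz => ⟨_, hair_coord hz⟩) (isClosedEmbedding_hair hp n).isClosed_range

/-- A connected set missing the centre lies in `F` or in one of the attached arcs. -/
lemma subset_of_isPreconnected [T2Space F] (hp : ∀ n, Continuous (p n)) (h0 : ∀ n, p n 0 = v)
    {S : Set (Hairy p)} (hS : IsPreconnected S) (hv : base p v ∉ S) :
    S ⊆ range (base p) ∨ ∃ n, S ⊆ {z | coord n z ≠ 0} := by
  by_cases h : S ⊆ range (base p)
  · exact Or.inl h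
  · obtain ⟨z, hz, hzb⟩ := not_subset.1 h
    obtain ⟨n, hn⟩ := (mem_range_base_or z).resolve_left hzb
    refine Or.inr ⟨n, hS.subset_of_closure_inter_subset (isOpen_coord_ne n) ⟨z, hz, hn⟩ ?_⟩
    rintro w ⟨hw, hwS⟩
    exact ((mem_range_hair h0).1 (closure_coord_ne_subset hp n hw)).resolve_right
      fun e => hv (e ▸ hwS)

open Classical in
lemma isPreconnected_inter_coord_eq_zero [T2Space F] (hp : ∀ n, Continuous (p n))
    (h0 : ∀ n, p n 0 = v) {C : Set (Hairy p)} (hC : IsPreconnected C) (hv : base p v ∈ C)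
    (n : ℕ) : IsPreconnected (C ∩ {z | coord n z = 0}) := by
  let c : Hairy p → Hairy p := fun z => if coord n z = 0 then z else base p v
  have hc : Continuous c := by
    refine continuous_if (fun z hz => ?_) continuousOn_id continuousOn_const
    have h1 : coord n z = 0 :=
      (isClosed_eq (continuous_coord n) continuous_const).frontier_subset hz
    rw [← frontier_compl] at hz
    exact ((mem_range_hair h0).1
      (closure_coord_ne_subset hp n (frontier_subset_closure hz))).resolve_left (not_not.2 h1)
  have : c '' C = C ∩ {z | coord n z = 0} := by
    ext z
    constructor
    · rintro ⟨w, hw, rfl⟩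
      by_cases h : coord n w = 0
      · simp only [c, if_pos h]
        exact ⟨hw, h⟩
      · simp only [c, if_neg h]
        exact ⟨hv, rfl⟩
    · rintro ⟨hz, h⟩
      exact ⟨z, hz, if_pos h⟩
  exact this ▸ hC.image c hc.continuousOn

lemma isPreconnected_inter_range_base [CompactSpace F] [T2Space F] (hp : ∀ n, Continuous (p n))
    (h0 : ∀ n, p n 0 = v) {C : Set (Hairy p)} (hcl : IsClosed C) (hC : IsPreconnected C) :
    IsPreconnected (C ∩ range (base p)) := by
  have := compactSpace hp
  by_cases hv : base p v ∈ C
  · let K : ℕ → Set (Hairy p) := fun N => C ∩ {z | ∀ n < N, coord n z = 0}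
    have hK : C ∩ range (base p) = ⋂ N, K N := by
      ext z
      simp only [mem_inter_iff, mem_range_base, mem_iInter, K, mem_ofPred_eq]
      exact ⟨fun h N => ⟨h.1, fun n _ => h.2 n⟩,
        fun h => ⟨(h 0).1, fun n => (h (n + 1)).2 n n.lt_succ_self⟩⟩
    rw [hK]
    refine isPreconnected_iInter_of_antitone ?_ ?_ ?_
    · exact fun M N hMN z hz => ⟨hz.1, fun n hn => hz.2 n (hn.trans_le hMN)⟩
    · intro N
      refine (hcl.inter ?_).isCompact
      simp only [ofPred_forall]
      exact isClosed_iInter fun n => isClosed_iInter fun _ =>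
        isClosed_eq (continuous_coord n) continuous_const
    · intro N
      induction N with
      | zero => simpa [K] using hC
      | succ N ih =>
        have := isPreconnected_inter_coord_eq_zero hp h0 ih ⟨hv, fun n _ => rfl⟩ N
        convert this using 1
        ext z
        simp only [K, mem_inter_iff, mem_ofPred_eq, Nat.lt_succ_iff_lt_or_eq, and_assoc]
        refine and_congr_right fun _ => ⟨fun h => ⟨fun n hn => h n (Or.inl hn), h N (Or.inr rfl)⟩,
          fun h n hn => hn.elim (h.1 n) fun e => e ▸ h.2⟩
  · rcases subset_of_isPreconnected hp h0 hC hv with h | ⟨n, h⟩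
    · rwa [inter_eq_left.2 h]
    · have : C ∩ range (base p) = ∅ := by
        rw [eq_empty_iff_forall_notMem]
        rintro z ⟨hz, hz'⟩
        exact h hz (mem_range_base.1 hz' n)
      rw [this]
      exact isPreconnected_empty

lemma isPreconnected_inter_range_hair [T2Space F] (hp : ∀ n, Continuous (p n))
    (h0 : ∀ n, p n 0 = v) {C : Set (Hairy p)} (hC : IsPreconnected C) (n : ℕ) :
    IsPreconnected (C ∩ range (hair p n)) := by
  by_cases hv : base p v ∈ C
  · have : C ∩ range (hair p n) = (fun z => hair p n (coord n z)) '' C := by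
      ext z
      constructor
      · rintro ⟨hz, t, rfl⟩
        exact ⟨_, hz, congrArg (hair p n) (coord_hair n t)⟩
      · rintro ⟨w, hw, rfl⟩
        refine ⟨?_, mem_range_self _⟩
        by_cases h : coord n w = 0
        · simpa only [h, hair_zero h0] using hv
        · simpa only [hair_coord h] using hw
    rw [this]
    exact hC.image _ ((continuous_hair hp n).comp (continuous_coord n)).continuousOn
  · by_cases hne : (C ∩ range (hair p n)).Nonempty
    · obtain ⟨z, hz, hz'⟩ := hne
      have hzn := ((mem_range_hair h0).1 hz').resolve_right fun e => hv (e ▸ hz)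
      have : C ⊆ range (hair p n) := by
        rcases subset_of_isPreconnected hp h0 hC hv with h | ⟨m, h⟩
        · exact absurd (mem_range_base.1 (h hz) n) hzn
        · obtain rfl : m = n := by
            by_contra hmn
            exact h hz (coord_eq_zero hzn hmn)
          exact fun w hw => ⟨_, hair_coord (h hw)⟩
      rwa [inter_eq_left.2 this]
    · rw [not_nonempty_iff_eq_empty.1 hne]
      exact isPreconnected_empty

lemma connectedInters [CompactSpace F] [T2Space F] (hp : ∀ n, Continuous (p n))
    (h0 : ∀ n, p n 0 = v) (hF : ConnectedInters F) : ConnectedInters (Hairy p) := by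
  intro A B hA hB cA cB
  have hbase : IsPreconnected (A ∩ B ∩ range (base p)) :=
    hF.inter_range isClosedEmbedding_base hA hB (isPreconnected_inter_range_base hp h0 hA cA)
      (isPreconnected_inter_range_base hp h0 hB cB)
  have hhair : ∀ n, IsPreconnected (A ∩ B ∩ range (hair p n)) := fun n =>
    connectedInters_unitInterval.inter_range (isClosedEmbedding_hair hp n) hA hB
      (isPreconnected_inter_range_hair hp h0 cA n) (isPreconnected_inter_range_hair hp h0 cB n)
  have missing : ∀ {S : Set (Hairy p)}, IsPreconnected S → base p v ∉ S → A ∩ B ⊆ S →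
      IsPreconnected (A ∩ B) := by
    intro S hS hv hAB
    rcases subset_of_isPreconnected hp h0 hS hv with h | ⟨n, h⟩
    · rwa [inter_eq_left.2 (hAB.trans h)] at hbase
    · have := hhair n
      rwa [inter_eq_left.2 (show A ∩ B ⊆ range (hair p n) from
        fun z hz => ⟨_, hair_coord (h (hAB hz))⟩)] at this
  by_cases hvA : base p v ∈ A
  · by_cases hvB : base p v ∈ B
    · refine isPreconnected_of_forall (base p v) fun z hz => ?_
      rcases mem_range_base_or z with h | ⟨n, h⟩
      · exact ⟨A ∩ B ∩ range (base p), inter_subset_left, ⟨⟨hvA, hvB⟩, mem_range_self _⟩, ⟨hz, h⟩, hbase⟩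
      · exact ⟨A ∩ B ∩ range (hair p n), inter_subset_left, ⟨⟨hvA, hvB⟩, ⟨0, hair_zero h0 n⟩⟩,
          ⟨hz, ⟨_, hair_coord h⟩⟩, hhair n⟩
    · exact missing cB hvB inter_subset_right
  · exact missing cA hvA inter_subset_left

end Connectedness

end Hairy

namespace Hairy

variable {F : Type} [TopologicalSpace F] {p : ℕ → I → F} {v : F}

lemma isArcCurve_hair (hp : ∀ n, Continuous (p n)) (h0 : ∀ n, p n 0 = v) {n : ℕ} {z : Hairy p}
    (hz : coord n z ≠ 0) : IsArcCurve (fun s => hair p n (coord n z * s)) (base p v) z where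
  cont := (continuous_hair hp n).comp (by fun_prop)
  inj _ _ h := mul_left_cancel₀ hz (hair_injective n h)
  zero := by rw [mul_zero, hair_zero h0]
  one := by rw [mul_one, hair_coord hz]

lemma exists_isArcCurve_of_coord_eq_zero (hp : ∀ n, Continuous (p n)) (h0 : ∀ n, p n 0 = v)
    {Y : Type} [TopologicalSpace Y] (hY : ∀ a b : Y, a ≠ b → ∃ φ, IsArcCurve φ a b)
    {f : Y → Hairy p} (hf : Continuous f) (hinj : Function.Injective f) {n : ℕ}
    (hfn : ∀ y, coord n (f y) = 0) {b : Y} (hb : f b = base p v) {w : Hairy p}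
    (hw : coord n w ≠ 0) (a : Y) : ∃ φ, IsArcCurve φ (f a) w := by
  have hψ := isArcCurve_hair hp h0 hw
  by_cases hab : a = b
  · exact ⟨_, (hab ▸ hb : f a = base p v) ▸ hψ⟩
  · obtain ⟨φ, hφ⟩ := hY a b hab
    refine (hφ.comp hf hinj).trans (hb ▸ hψ) fun s t hst => ?_
    have := congrArg (coord n) hst
    rw [hfn, coord_hair] at this
    exact (mul_eq_zero.1 this.symm).resolve_left hw

lemma exists_isArcCurve [CompactSpace F] [T2Space F] (hp : ∀ n, Continuous (p n))
    (h0 : ∀ n, p n 0 = v) (hF : ∀ a b : F, a ≠ b → ∃ φ, IsArcCurve φ a b) {z w : Hairy p}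
    (hzw : z ≠ w) : ∃ φ, IsArcCurve φ z w := by
  have hI : ∀ a b : I, a ≠ b → ∃ φ, IsArcCurve φ a b := fun _ _ => exists_isArcCurve_unitInterval
  have hbase : Continuous (base p) := isClosedEmbedding_base.continuous
  rcases mem_range_base_or w with ⟨b, rfl⟩ | ⟨n, hn⟩
  · rcases mem_range_base_or z with ⟨a, rfl⟩ | ⟨m, hm⟩
    · obtain ⟨φ, hφ⟩ := hF a b fun h => hzw (h ▸ rfl)
      exact ⟨_, hφ.comp hbase base_injective⟩
    · obtain ⟨φ, hφ⟩ := exists_isArcCurve_of_coord_eq_zero hp h0 hF hbase base_injective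
        (coord_base m) rfl hm b
      exact ⟨_, hφ.symm⟩
  · rcases mem_range_base_or z with ⟨a, rfl⟩ | ⟨m, hm⟩
    · exact exists_isArcCurve_of_coord_eq_zero hp h0 hF hbase base_injective (coord_base n) rfl
        hn a
    · by_cases hmn : n = m
      · subst hmn
        rw [← hair_coord hm, ← hair_coord hn] at hzw ⊢
        obtain ⟨φ, hφ⟩ := hI _ _ fun h => hzw (congrArg (hair p n) h)
        exact ⟨_, hφ.comp (continuous_hair hp n) (hair_injective n)⟩
      · rw [← hair_coord hm]
        exact exists_isArcCurve_of_coord_eq_zero hp h0 hI (continuous_hair hp m)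
          (hair_injective m) (coord_hair_of_ne hmn) (hair_zero h0 m) hn _

lemma connectedSpace [CompactSpace F] [T2Space F] (hp : ∀ n, Continuous (p n))
    (h0 : ∀ n, p n 0 = v) (hF : ∀ a b : F, a ≠ b → ∃ φ, IsArcCurve φ a b) :
    ConnectedSpace (Hairy p) := by
  have : PathConnectedSpace (Hairy p) := by
    refine ⟨⟨base p v⟩, fun z w => ?_⟩
    by_cases h : z = w
    · exact h ▸ Joined.refl z
    · obtain ⟨φ, hφ⟩ := exists_isArcCurve hp h0 hF h
      exact ⟨⟨⟨φ, hφ.cont⟩, hφ.zero, hφ.one⟩⟩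
  infer_instance

lemma isRamificationPoint_base [T2Space F] (hp : ∀ n, Continuous (p n)) (h0 : ∀ n, p n 0 = v) :
    IsRamificationPoint (base p v) := by
  refine IsStar.isRamificationPoint (ℓ := fun (i : Fin 3) t => hair p i t)
    ⟨fun i => continuous_hair hp i, fun i => hair_zero h0 i, fun {i j s t} h => ?_⟩
  have hs := congrArg (coord (i : ℕ)) h
  by_cases hij : i = j
  · subst hij
    exact ⟨hair_injective _ h, Or.inr rfl⟩
  · have hij' : (i : ℕ) ≠ j := Fin.val_injective.ne hij
    have ht := congrArg (coord (j : ℕ)) h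
    rw [coord_hair, coord_hair_of_ne hij'] at hs
    rw [coord_hair, coord_hair_of_ne hij'.symm] at ht
    exact ⟨hs.trans ht, Or.inl hs⟩

lemma eq_base_of_isRamificationPoint [CompactSpace F] [T2Space F] (hp : ∀ n, Continuous (p n))
    (h0 : ∀ n, p n 0 = v) (hv : ∀ x : F, IsRamificationPoint x → x = v) {z : Hairy p}
    (hz : IsRamificationPoint z) : z = base p v := by
  by_contra hne
  obtain ⟨ℓ, hℓ⟩ := hz.exists_isStar
  obtain ⟨δ, hδ, hav⟩ := hℓ.exists_shrink_ne hne
  have hs := hℓ.shrink hδ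
  have hmem : ∀ i t, ℓ i (δ * t) ∈ ⋃ i, range fun t => ℓ i (δ * t) := fun i t =>
    mem_iUnion.2 ⟨i, t, rfl⟩
  rcases subset_of_isPreconnected hp h0 hs.isPreconnected
    (by simpa using hav) with h | ⟨n, h⟩
  · have hinj : InjOn (fun z : Hairy p => z.1.1) (range (base p)) := by
      rintro _ ⟨a, rfl⟩ _ ⟨b, rfl⟩ hab
      exact congrArg (base p) hab
    have hstar := hs.comp (continuous_fst.comp continuous_subtype_val).continuousOn hinj
      fun i t => h (hmem i t)
    have hzv := hv _ hstar.isRamificationPoint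
    obtain ⟨a, ha⟩ := h (hmem 0 0)
    rw [hs.zero] at ha
    subst ha
    exact hne (congrArg (base p) hzv)
  · refine not_isStar_three_real (hs.comp (f := fun z => (coord n z : ℝ))
      (continuous_subtype_val.comp (continuous_coord n)).continuousOn ?_ fun i t => h (hmem i t))
    intro a ha b hb hab
    rw [← hair_coord ha, ← hair_coord hb, Subtype.ext hab]

end Hairy

lemma exists_frequent_dense_sequence (Y : Type) [TopologicalSpace Y]
    [TopologicalSpace.SeparableSpace Y] [Nonempty Y] :
    ∃ u : ℕ → Y, ∀ y, MapClusterPt y atTop u := by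
  refine ⟨fun n => TopologicalSpace.denseSeq Y n.unpair.1, fun y => ?_⟩
  rw [mapClusterPt_iff_frequently]
  intro s hs
  rw [frequently_atTop]
  intro N
  obtain ⟨_, hm, m, rfl⟩ := mem_closure_iff_nhds.1 (TopologicalSpace.denseRange_denseSeq Y y) s hs
  exact ⟨Nat.pair m N, Nat.right_le_pair m N, by simpa using hm⟩

/-- Every non-degenerate fan `F` embeds into a fan `X` whose set of non-smooth points
is exactly the embedded copy of `F`. -/
theorem statement3 {F : Type} [MetricSpace F] (hF : IsFan F)
    (hnd : ∃ x y : F, x ≠ y) :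
    ∃ (X : Type) (mX : MetricSpace X), letI := mX
      ∃ (v : X) (e : F → X),
        IsFan X ∧ IsFanTop v ∧ Topology.IsEmbedding e ∧ NS X v = Set.range e := by
  obtain ⟨v, hram, ℓ, hℓ⟩ := hF.exists_centre hnd
  obtain ⟨⟨_, _, _, _, hFarc, hFuni⟩, -⟩ := hF
  replace hFarc : ∀ a b : F, a ≠ b → ∃ φ, IsArcCurve φ a b := fun a b hab => by
    obtain ⟨A, ha, hb⟩ := hFarc a b hab
    obtain ⟨φ, hφ, -⟩ := exists_isArcCurve ha hb hab
    exact ⟨φ, hφ⟩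
  have hjoin : ∀ a b : F, Joined a b := fun a b => by
    by_cases h : a = b
    · exact h ▸ Joined.refl a
    · obtain ⟨φ, hφ⟩ := hFarc a b h
      exact ⟨⟨⟨φ, hφ.cont⟩, hφ.zero, hφ.one⟩⟩
  obtain ⟨u, hu⟩ := exists_frequent_dense_sequence (F × F)
  let m : I := ⟨1 / 2, by norm_num, by norm_num⟩
  obtain ⟨p, hp, h0, hpm, hp1⟩ : ∃ p : ℕ → I → F, (∀ n, Continuous (p n)) ∧
      (∀ n, p n 0 = v) ∧ (∀ n, p n m = (u n).1) ∧ ∀ n, p n 1 = (u n).2 := by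
    refine ⟨fun n => (hjoin v (u n).1).somePath.trans (hjoin (u n).1 (u n).2).somePath,
      fun n => Path.continuous _, fun n => Path.source _, fun n => ?_, fun n => Path.target _⟩
    beta_reduce
    rw [Path.trans_apply, dif_pos le_rfl]
    convert Path.target _
    norm_num [m]
  have hcomp := Hairy.compactSpace hp
  have hconn := Hairy.connectedSpace hp h0 hFarc
  have hX := Hairy.connectedInters hp h0 hFuni.connectedInters
  have hfan : IsFan (Hairy p) := by
    refine ⟨⟨⟨Hairy.base p v⟩, hcomp, hconn, inferInstance, fun z w hzw => ?_,
      hX.hereditarilyUnicoherent⟩, fun z w hz hw => ?_⟩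
    · obtain ⟨φ, hφ⟩ := Hairy.exists_isArcCurve hp h0 hFarc hzw
      exact ⟨_, hφ.isArcEndpoint_left, hφ.isArcEndpoint_right⟩
    · rw [Hairy.eq_base_of_isRamificationPoint hp h0 hram hz,
        Hairy.eq_base_of_isRamificationPoint hp h0 hram hw]
  refine ⟨Hairy p, TopologicalSpace.metrizableSpaceMetric _, Hairy.base p v, Hairy.base p, hfan,
    Or.inl (Hairy.isRamificationPoint_base hp h0), Hairy.isClosedEmbedding_base.isEmbedding, ?_⟩
  let : MetricSpace (Hairy p) := TopologicalSpace.metrizableSpaceMetric _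
  refine Subset.antisymm (fun z hz => ?_) ?_
  · refine (Hairy.mem_range_base_or z).resolve_right ?_
    rintro ⟨n, hn⟩
    exact not_nsPoint_of_retract hX (Hairy.continuous_hair hp n) (Hairy.hair_injective n)
      (Hairy.hair_zero h0 n) (Hairy.continuous_coord n) hn (fun w hw => Hairy.hair_coord hw) hz
  · rintro _ ⟨x, rfl⟩
    obtain ⟨A₀, y, hA₀, hcl, hy⟩ : ∃ (A₀ : Set (Hairy p)) (y : F),
        ArcConn A₀ (Hairy.base p v) (Hairy.base p x) ∧ IsClosed A₀ ∧ Hairy.base p y ∉ A₀ := by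
      by_cases hxv : v = x
      · subst hxv
        obtain ⟨a, b, hab⟩ := hnd
        obtain ⟨y, hy⟩ : ∃ y, y ≠ v := by
          by_contra! h
          exact hab ((h a).trans (h b).symm)
        exact ⟨_, y, Or.inl ⟨rfl, rfl⟩, isClosed_singleton,
          fun h => hy (Hairy.base_injective h)⟩
      · obtain ⟨φ, hφ⟩ := hFarc v x hxv
        obtain ⟨y, hy⟩ : ∃ y, y ∉ range φ := by
          by_contra! h
          exact hφ.isArcEndpoint_left.not_isStar_two hℓ fun _ _ => h _
        have hφ' := hφ.comp Hairy.isClosedEmbedding_base.continuous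
          (Hairy.base_injective (p := p))
        refine ⟨_, y, hφ'.arcConn, (hφ'.cont.isClosedEmbedding hφ'.inj).isClosed_range, ?_⟩
        rintro ⟨t, ht⟩
        exact hy ⟨t, Hairy.base_injective ht⟩
    obtain ⟨k, hk, hlim⟩ := (hu (y, x)).tendsto_subseq
    refine nsPoint_of_curves (a := fun i => Hairy.hair p (k i)) (m := m)
      (y := Hairy.base p y) (fun i => ⟨Hairy.continuous_hair hp _, Hairy.hair_injective _,
        Hairy.hair_zero h0 _, rfl⟩) ?_ ?_ ?_ hA₀ hcl hy
    · intro i j hij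
      by_contra hne
      have := congrArg (Hairy.coord (k i)) hij
      simp only [Hairy.coord_hair] at this
      rw [Hairy.coord_hair_of_ne (hk.injective.ne hne)] at this
      exact one_ne_zero this
    · refine Hairy.tendsto_hair hk.tendsto_atTop ?_
      simp only [hp1]
      exact (continuous_snd.tendsto _).comp hlim
    · refine Hairy.tendsto_hair hk.tendsto_atTop ?_
      simp only [hpm]
      exact (continuous_fst.tendsto _).comp hlim
end
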